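/- arXiv:1903.09070 — 3 statements merged into one kernel-verified Lean document; each statement's English description precedes it below -/
import Mathlib

section
/- Let f(z) = Σ_{k=0}^∞ a_k z^k, with a_k > 0 for all k, be an entire function. Suppose that the quotients q_n(f) := a_{n-1}²/(a_{n-2} a_n) are increasing in n (q_2 ≤ q_3 ≤ q_4 ≤ ...) and lim_{n→∞} q_n(f) = c < q_∞. Then f does not belong to the Laguerre–Pólya class. -/
open Filter Finset

/-- The Laguerre–Pólya class: `f(x) = c xⁿ e^{-αx²+βx} ∏ₖ (1 - x/xₖ) e^{x/xₖ}`,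
with `α ≥ 0`, `xₖ ≠ 0`, `∑ xₖ⁻² < ∞`; the product is over an arbitrary
(possibly finite or empty) index set `I ⊆ ℕ`. -/
def LaguerrePolya (f : ℝ → ℝ) : Prop :=
  ∃ (c α β : ℝ) (n : ℕ) (I : Set ℕ) (x : ℕ → ℝ),
    0 ≤ α ∧ (∀ k ∈ I, x k ≠ 0) ∧
    Summable (fun k : I => ((x k)⁻¹) ^ 2) ∧
    ∀ t : ℝ, f t = c * t ^ n * Real.exp (-α * t ^ 2 + β * t) *
      ∏' k : I, ((1 - t / x (k : ℕ)) * Real.exp (t / x (k : ℕ)))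

/-- `q_∞ := inf {a² : a > 1, g_a ∈ L-P}` where `g_a(x) = ∑ⱼ xʲ a^{-j²}`
is the partial theta function. -/
noncomputable def qInfty : ℝ :=
  sInf {s : ℝ | ∃ a : ℝ, 1 < a ∧ s = a ^ 2 ∧
    LaguerrePolya (fun x => ∑' j : ℕ, x ^ j / a ^ (j ^ 2))}

/-! ### Part A: consequences of membership in the Laguerre–Pólya class -/

lemma log_one_add_sub_bound {u : ℝ} (hu : 0 ≤ u) : |Real.log (1 + u) - u| ≤ u ^ 2 := by
  have h1 : Real.log (1 + u) ≤ u := by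
    have := Real.log_le_sub_one_of_pos (show (0:ℝ) < 1 + u by linarith)
    linarith
  have h2 : 1 - (1 + u)⁻¹ ≤ Real.log (1 + u) :=
    Real.one_sub_inv_le_log_of_pos (by linarith)
  have h3 : u - u ^ 2 ≤ 1 - (1 + u)⁻¹ := by
    have h : 1 - (1 + u)⁻¹ = u / (1 + u) := by field_simp; ring
    rw [h, le_div_iff₀ (by linarith)]
    nlinarith [pow_nonneg hu 3]
  rw [abs_le]
  constructor <;> nlinarith [sq_nonneg u]

lemma log_one_add_cubic {u : ℝ} (hu : 0 ≤ u) (hu' : u ≤ 1 / 2) :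
    |Real.log (1 + u) - (u - u ^ 2 / 2 + u ^ 3 / 3)| ≤ 2 * u ^ 4 := by
  have h := Real.abs_log_sub_add_sum_range_le (x := -u) (by rw [abs_neg, abs_of_nonneg hu]; linarith) 3
  rw [abs_neg, abs_of_nonneg hu] at h
  simp only [Finset.sum_range_succ, Finset.sum_range_zero] at h
  norm_num at h
  have h2 : u ^ 4 / (1 - u) ≤ 2 * u ^ 4 := by
    rw [div_le_iff₀ (by linarith)]
    nlinarith [pow_nonneg hu 4]
  refine le_trans (le_of_eq_of_le ?_ h) h2
  congr 1
  ring

lemma real_summable {a : ℕ → ℝ} (hent : ∀ z : ℂ, Summable fun k : ℕ => (a k : ℂ) * z ^ k) (x : ℝ) :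
    Summable fun k : ℕ => a k * x ^ k := by
  have := hent (x : ℂ)
  exact_mod_cast this

lemma LP_normal_form (a : ℕ → ℝ) (hpos : ∀ k, 0 < a k)
    (hs : ∀ x : ℝ, Summable fun k : ℕ => a k * x ^ k)
    (hLP : LaguerrePolya (fun x : ℝ => ∑' k : ℕ, a k * x ^ k)) :
    ∃ (I : Set ℕ) (y : I → ℝ) (β : ℝ), (∀ k, 0 < y k) ∧ Summable y ∧ ∑' k, y k ≤ β ∧
      (∀ k, ∑' j : ℕ, a j * (-(1 / y k)) ^ j = 0) ∧
      ∀ t : ℝ, 0 ≤ t → Real.log ((∑' j : ℕ, a j * t ^ j) / a 0) =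
        (β - ∑' k, y k) * t + ∑' k, Real.log (1 + t * y k) := by
  obtain ⟨c, α, β, n, I, x, hα, hx, hsum, hf⟩ := hLP
  have hge : ∀ t : ℝ, 0 ≤ t → a 0 ≤ ∑' k : ℕ, a k * t ^ k := by
    intro t ht
    have := (hs t).le_tsum 0 (fun j _ => mul_nonneg (hpos j).le (pow_nonneg ht j))
    simpa using this
  have h00 : ∑' k : ℕ, a k * (0:ℝ) ^ k = a 0 := by
    rw [tsum_eq_single 0]
    · simp
    · intro b hb; simp [hb]
  have h0 := hf 0
  simp only [h00] at h0
  simp at h0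
  have hn : n = 0 := by
    by_contra hn
    rw [zero_pow hn] at h0
    have := hpos 0
    simp at h0
    linarith
  subst hn
  simp at h0
  subst h0
  -- zeros
  have hzero : ∀ k : I, ∑' j : ℕ, a j * (x k) ^ j = 0 := by
    intro k
    have h := hf (x k)
    simp only at h
    rw [h, tprod_of_exists_eq_zero ⟨k, by rw [div_self (hx k k.2)]; simp⟩]
    simp
  have hneg : ∀ k : I, x k < 0 := by
    intro k
    by_contra hk
    have := hge (x k) (not_lt.mp hk)
    rw [hzero k] at this
    linarith [hpos 0]
  set y : I → ℝ := fun k => -(x k)⁻¹ with hy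
  have hy0 : ∀ k, 0 < y k := fun k => by
    have := inv_lt_zero.mpr (hneg k)
    simp only [hy]; linarith
  have hy2 : Summable (fun k : I => y k ^ 2) := by
    simpa [hy] using hsum
  have hpos1 : ∀ t : ℝ, 0 ≤ t → ∀ k, 0 < 1 + t * y k := fun t ht k => by
    have := mul_nonneg ht (hy0 k).le
    linarith
  have hLs : ∀ t : ℝ, 0 ≤ t → Summable (fun k : I => Real.log (1 + t * y k) - t * y k) := by
    intro t ht
    refine Summable.of_norm_bounded (g := fun k : I => t ^ 2 * y k ^ 2) (hy2.mul_left _) ?_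
    intro k
    have := log_one_add_sub_bound (mul_nonneg ht (hy0 k).le)
    rw [Real.norm_eq_abs]
    rwa [mul_pow] at this
  have hL : ∀ t : ℝ, 0 ≤ t → Real.log ((∑' j : ℕ, a j * t ^ j) / a 0) =
      -α * t ^ 2 + β * t + ∑' k : I, (Real.log (1 + t * y k) - t * y k) := by
    intro t ht
    have h := hf t
    simp only at h
    have hfac : ∀ k : I, ((1 - t / x k) * Real.exp (t / x k)) =
        (1 + t * y k) * Real.exp (-(t * y k)) := by
      intro k
      simp only [hy, div_eq_mul_inv]
      congr 2 <;> ring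
    have hlog : ∀ k : I, Real.log ((1 + t * y k) * Real.exp (-(t * y k))) =
        Real.log (1 + t * y k) - t * y k := by
      intro k
      rw [Real.log_mul (hpos1 t ht k).ne' (Real.exp_pos _).ne', Real.log_exp]; ring
    have hprod := Real.rexp_tsum_eq_tprod
      (f := fun k : I => (1 + t * y k) * Real.exp (-(t * y k)))
      (fun k => mul_pos (hpos1 t ht k) (Real.exp_pos _))
      (by simp only [hlog]; exact hLs t ht)
    simp only [hlog] at hprod
    simp only [hfac, ← hprod] at h
    rw [h, pow_zero, mul_one, mul_assoc, ← Real.exp_add,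
      mul_div_cancel_left₀ _ (hpos 0).ne', Real.log_exp]
  have hLnn : ∀ t : ℝ, 0 ≤ t → 0 ≤ Real.log ((∑' j : ℕ, a j * t ^ j) / a 0) := by
    intro t ht
    apply Real.log_nonneg
    rw [le_div_iff₀ (hpos 0), one_mul]
    exact hge t ht
  have hterm : ∀ t : ℝ, 0 ≤ t → ∀ k : I, Real.log (1 + t * y k) - t * y k ≤ 0 := by
    intro t ht k
    have := Real.log_le_sub_one_of_pos (hpos1 t ht k)
    linarith
  have hfin : ∀ (F : Finset I) (t : ℝ), 0 ≤ t →
      0 ≤ -α * t ^ 2 + β * t + ∑ k ∈ F, (Real.log (1 + t * y k) - t * y k) := by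
    intro F t ht
    have h1 := hLnn t ht
    rw [hL t ht] at h1
    have h2 : ∑' k : I, (Real.log (1 + t * y k) - t * y k) ≤
        ∑ k ∈ F, (Real.log (1 + t * y k) - t * y k) := by
      have := (hLs t ht).neg.sum_le_tsum F (fun k _ => by
        have := hterm t ht k; simp only [Left.nonneg_neg_iff]; exact this)
      rw [tsum_neg, Finset.sum_neg_distrib] at this
      linarith
    linarith
  have hα0 : α = 0 := by
    by_contra hne
    have hα' : 0 < α := lt_of_le_of_ne hα (Ne.symm hne)
    have h := hfin ∅ ((|β| + 1) / α) (by positivity)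
    simp only [Finset.sum_empty, add_zero] at h
    set t := (|β| + 1) / α with htd
    have ht : 0 < t := by positivity
    have hat : α * t = |β| + 1 := by rw [htd]; field_simp
    have : -α * t ^ 2 + β * t = t * (β - α * t) := by ring
    rw [this, hat] at h
    have hb := le_abs_self β
    nlinarith
  have hS : ∀ F : Finset I, ∑ k ∈ F, y k ≤ β := by
    intro F
    by_contra hlt
    push Not at hlt
    set D := ∑ k ∈ F, y k - β with hD
    have hDpos : 0 < D := by rw [hD]; linarith
    set E := ∑ k ∈ F, 2 * Real.sqrt (y k) with hE
    have hE0 : 0 ≤ E := Finset.sum_nonneg (fun k _ => by positivity)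
    have key : ∀ s : ℝ, 0 < s → D * s ≤ E := by
      intro s hs0
      have h := hfin F (s ^ 2) (by positivity)
      rw [hα0, Finset.sum_sub_distrib, ← Finset.mul_sum] at h
      have hl : ∑ k ∈ F, Real.log (1 + s ^ 2 * y k) ≤ ∑ k ∈ F, s * (2 * Real.sqrt (y k)) := by
        apply Finset.sum_le_sum
        intro k _
        have hsq : Real.sqrt (y k) ^ 2 = y k := Real.sq_sqrt (hy0 k).le
        have hr : 0 ≤ Real.sqrt (y k) := Real.sqrt_nonneg _
        have h1 : 1 + s ^ 2 * y k ≤ (1 + s * Real.sqrt (y k)) ^ 2 := by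
          have : s ^ 2 * y k = (s * Real.sqrt (y k)) ^ 2 := by rw [mul_pow, hsq]
          rw [this]
          nlinarith [mul_nonneg hs0.le hr]
        have h2 := Real.log_le_log (hpos1 (s ^ 2) (by positivity) k) h1
        rw [Real.log_pow] at h2
        have h3 := Real.log_le_sub_one_of_pos
          (show 0 < 1 + s * Real.sqrt (y k) by have := mul_nonneg hs0.le hr; linarith)
        push_cast at h2
        linarith
      rw [← Finset.mul_sum] at hl
      have : s * (D * s) ≤ s * E := by
        rw [hD]; nlinarith
      exact le_of_mul_le_mul_left this hs0
    have := key ((E + 1) / D) (by positivity)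
    rw [mul_div_cancel₀ _ hDpos.ne'] at this
    linarith
  have hys : Summable y := summable_of_sum_le (fun k => (hy0 k).le) hS
  refine ⟨I, y, β, hy0, hys, hys.tsum_le_of_sum_le hS, ?_, ?_⟩
  · intro k
    have : -(1 / y k) = x k := by simp [hy]
    rw [this]; exact hzero k
  · intro t ht
    rw [hL t ht, hα0]
    have h1 : Summable (fun k : I => t * y k) := hys.mul_left t
    have h2 : Summable (fun k : I => Real.log (1 + t * y k)) := by
      have := (hLs t ht).add h1
      simpa using this
    rw [h2.tsum_sub h1, tsum_mul_left]
    ring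
open Asymptotics in
lemma cubic_coeff_zero (A B C : ℝ)
    (h : (fun t : ℝ => A * t + B * t ^ 2 + C * t ^ 3) =O[nhdsWithin 0 (Set.Ioi 0)]
      (fun t : ℝ => t ^ 4)) : A = 0 ∧ B = 0 ∧ C = 0 := by
  obtain ⟨K, hK⟩ := h.bound
  have aux : ∀ (g : ℝ → ℝ) (m : ℕ), Continuous g →
      (∀ᶠ t in nhdsWithin (0:ℝ) (Set.Ioi 0), |g t| ≤ K * t ^ (m + 1)) → g 0 = 0 := by
    intro g m hg hb
    have h1 : Tendsto g (nhdsWithin (0:ℝ) (Set.Ioi 0)) (nhds (g 0)) :=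
      (hg.tendsto 0).mono_left nhdsWithin_le_nhds
    have h2 : Tendsto (fun t : ℝ => K * t ^ (m + 1)) (nhdsWithin (0:ℝ) (Set.Ioi 0)) (nhds 0) := by
      have : Continuous (fun t : ℝ => K * t ^ (m + 1)) := by fun_prop
      have := (this.tendsto 0).mono_left (nhdsWithin_le_nhds (s := Set.Ioi (0:ℝ)))
      simpa using this
    exact tendsto_nhds_unique h1 (squeeze_zero_norm' hb h2)
  have hp : ∀ᶠ t in nhdsWithin (0:ℝ) (Set.Ioi 0), (0:ℝ) < t := self_mem_nhdsWithin
  have div1 : ∀ (t G : ℝ) (m : ℕ), 0 < t → |t * G| ≤ K * t ^ (m + 1) → |G| ≤ K * t ^ m := by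
    intro t G m ht hh
    rw [abs_mul, abs_of_pos ht, pow_succ] at hh
    have : t * |G| ≤ t * (K * t ^ m) := by linarith
    exact le_of_mul_le_mul_left this ht
  have hK1 : ∀ᶠ t in nhdsWithin (0:ℝ) (Set.Ioi 0), |A + B * t + C * t ^ 2| ≤ K * t ^ 3 := by
    filter_upwards [hK, hp] with t ht hpt
    rw [Real.norm_eq_abs, Real.norm_eq_abs, abs_of_pos (pow_pos hpt 4)] at ht
    apply div1 t _ 3 hpt
    convert ht using 2
    ring
  have hA : A = 0 := by
    have := aux (fun t => A + B * t + C * t ^ 2) 2 (by fun_prop) hK1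
    simpa using this
  have hK2 : ∀ᶠ t in nhdsWithin (0:ℝ) (Set.Ioi 0), |B + C * t| ≤ K * t ^ 2 := by
    filter_upwards [hK1, hp] with t ht hpt
    apply div1 t _ 2 hpt
    convert ht using 2
    rw [hA]; ring
  have hB : B = 0 := by
    have := aux (fun t => B + C * t) 1 (by fun_prop) hK2
    simpa using this
  have hK3 : ∀ᶠ t in nhdsWithin (0:ℝ) (Set.Ioi 0), |C| ≤ K * t ^ 1 := by
    filter_upwards [hK2, hp] with t ht hpt
    apply div1 t _ 1 hpt
    convert ht using 2
    rw [hB]; ring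
  have hC : C = 0 := by
    have := aux (fun _ => C) 0 (by fun_prop) hK3
    simpa using this
  exact ⟨hA, hB, hC⟩

open Asymptotics in
lemma power_sums (a : ℕ → ℝ) (hpos : ∀ k, 0 < a k)
    (hs : ∀ x : ℝ, Summable fun k : ℕ => a k * x ^ k)
    {ι : Type} (y : ι → ℝ) (β : ℝ) (hy0 : ∀ k, 0 < y k) (hys : Summable y)
    (hle : ∑' k, y k ≤ β) (hlog : ∀ t : ℝ, 0 ≤ t → Real.log ((∑' j : ℕ, a j * t ^ j) / a 0) =
        (β - ∑' k, y k) * t + ∑' k, Real.log (1 + t * y k)) :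
    Summable (fun k => y k ^ 2) ∧ Summable (fun k => y k ^ 3) ∧
    β = a 1 / a 0 ∧ ∑' k, y k ^ 2 = (a 1 / a 0) ^ 2 - 2 * (a 2 / a 0) ∧
    ∑' k, y k ^ 3 = (a 1 / a 0) ^ 3 - 3 * (a 1 / a 0) * (a 2 / a 0) + 3 * (a 3 / a 0) := by
  have hyb : ∀ k, y k ≤ β := fun k => (hys.le_tsum k (fun j _ => (hy0 j).le)).trans hle
  have hstep : ∀ m : ℕ, Summable (fun k => y k ^ m) → Summable (fun k => y k ^ (m + 1)) := by
    intro m hm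
    refine Summable.of_nonneg_of_le (fun k => pow_nonneg (hy0 k).le _) (fun k => ?_)
      (hm.mul_right β)
    rw [pow_succ]
    exact mul_le_mul_of_nonneg_left (hyb k) (pow_nonneg (hy0 k).le _)
  have hy1 : Summable (fun k => y k ^ 1) := by simpa using hys
  have hy2 := hstep 1 hy1
  have hy3 := hstep 2 hy2
  have hy4 := hstep 3 hy3
  norm_num at hy2 hy3 hy4
  refine ⟨hy2, hy3, ?_⟩
  set S := ∑' k, y k with hS
  set p2 := ∑' k, y k ^ 2 with hp2
  set p3 := ∑' k, y k ^ 3 with hp3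
  set p4 := ∑' k, y k ^ 4 with hp4
  set b1 := a 1 / a 0 with hb1
  set b2 := a 2 / a 0 with hb2
  set b3 := a 3 / a 0 with hb3
  set T : ℝ := ∑' j : ℕ, a (j + 4) with hT
  set l := nhdsWithin (0:ℝ) (Set.Ioi 0) with hl
  have hp : ∀ᶠ t in l, (0:ℝ) < t := self_mem_nhdsWithin
  have hsmall : ∀ ε : ℝ, 0 < ε → ∀ᶠ t in l, t ≤ ε := by
    intro ε hε
    exact (eventually_le_nhds hε).filter_mono nhdsWithin_le_nhds
  have hβ0 : 0 ≤ β := le_trans (tsum_nonneg (fun k => (hy0 k).le)) hle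
  -- left expansion
  have h1 : (fun t : ℝ => ((β - S) * t + ∑' k, Real.log (1 + t * y k)) -
      (β * t - p2 / 2 * t ^ 2 + p3 / 3 * t ^ 3)) =O[l] (fun t : ℝ => t ^ 4) := by
    refine IsBigO.of_bound (2 * p4) ?_
    filter_upwards [hp, hsmall (1 / (2 * (β + 1))) (by positivity)] with t ht ht'
    have htb : t * (β + 1) ≤ 1 / 2 := by
      have := mul_le_mul_of_nonneg_right ht' (show (0:ℝ) ≤ β + 1 by linarith)
      have e : 1 / (2 * (β + 1)) * (β + 1) = 1 / 2 := by field_simp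
      linarith
    have hu : ∀ k, 0 ≤ t * y k ∧ t * y k ≤ 1 / 2 := fun k =>
      ⟨mul_nonneg ht.le (hy0 k).le, by nlinarith [hyb k]⟩
    have hsumP : HasSum (fun k => t * y k - (t * y k) ^ 2 / 2 + (t * y k) ^ 3 / 3)
        (t * S - t ^ 2 * p2 / 2 + t ^ 3 * p3 / 3) := by
      simp only [mul_pow]
      exact ((hys.hasSum.mul_left t).sub ((hy2.hasSum.mul_left (t ^ 2)).div_const 2)).add
        ((hy3.hasSum.mul_left (t ^ 3)).div_const 3)
    have hbd : ∀ k, |Real.log (1 + t * y k) - (t * y k - (t * y k) ^ 2 / 2 + (t * y k) ^ 3 / 3)|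
        ≤ 2 * t ^ 4 * y k ^ 4 := fun k => by
      have := log_one_add_cubic (hu k).1 (hu k).2
      rw [mul_pow t (y k) 4] at this
      linarith
    have hds : Summable (fun k => Real.log (1 + t * y k) -
        (t * y k - (t * y k) ^ 2 / 2 + (t * y k) ^ 3 / 3)) :=
      Summable.of_norm_bounded (g := fun k => 2 * t ^ 4 * y k ^ 4) (hy4.mul_left _) hbd
    have hls : Summable (fun k => Real.log (1 + t * y k)) := by
      have := hds.add hsumP.summable
      simpa using this
    have hnorm := tsum_of_norm_bounded (f := fun k => Real.log (1 + t * y k) -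
        (t * y k - (t * y k) ^ 2 / 2 + (t * y k) ^ 3 / 3)) (hy4.hasSum.mul_left (2 * t ^ 4)) hbd
    rw [hls.tsum_sub hsumP.summable, hsumP.tsum_eq] at hnorm
    rw [Real.norm_eq_abs (t ^ 4), abs_of_pos (pow_pos ht 4)]
    calc _ = ‖∑' k, Real.log (1 + t * y k) - (t * S - t ^ 2 * p2 / 2 + t ^ 3 * p3 / 3)‖ := by
          congr 1; ring
      _ ≤ _ := hnorm
      _ = _ := by ring
  -- right expansion
  set v : ℝ → ℝ := fun t => (∑' j : ℕ, a j * t ^ j) / a 0 - 1 with hv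
  set P : ℝ → ℝ := fun t => b1 * t + b2 * t ^ 2 + b3 * t ^ 3 with hP
  have hTs : Summable (fun j : ℕ => a (j + 4)) := by
    have := hs 1
    simp only [one_pow, mul_one] at this
    exact (summable_nat_add_iff 4).mpr this
  have hvP : ∀ t : ℝ, v t - P t = (∑' j : ℕ, a (j + 4) * t ^ (j + 4)) / a 0 := by
    intro t
    have h := (hs t).sum_add_tsum_nat_add 4
    simp only [Finset.sum_range_succ, Finset.sum_range_zero] at h
    simp only [hv, hP, ← h, hb1, hb2, hb3]
    have := (hpos 0).ne'
    field_simp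
    ring
  have hrb : ∀ t : ℝ, 0 < t → t ≤ 1 → 0 ≤ v t - P t ∧ v t - P t ≤ T / a 0 * t ^ 4 := by
    intro t ht ht1
    rw [hvP]
    have hss : Summable (fun j : ℕ => a (j + 4) * t ^ (j + 4)) :=
      (summable_nat_add_iff 4).mpr (hs t)
    constructor
    · exact div_nonneg (tsum_nonneg (fun j => mul_nonneg (hpos _).le (pow_nonneg ht.le _)))
        (hpos 0).le
    · have : ∑' j : ℕ, a (j + 4) * t ^ (j + 4) ≤ ∑' j : ℕ, a (j + 4) * t ^ 4 := by
        refine hss.tsum_le_tsum (fun j => ?_) (hTs.mul_right _)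
        refine mul_le_mul_of_nonneg_left ?_ (hpos _).le
        exact pow_le_pow_of_le_one ht.le ht1 (by omega)
      rw [tsum_mul_right] at this
      rw [div_mul_eq_mul_div]
      exact div_le_div_of_nonneg_right this (hpos 0).le
  have h3 : (fun t => v t - P t) =O[l] (fun t : ℝ => t ^ 4) := by
    refine IsBigO.of_bound (T / a 0) ?_
    filter_upwards [hp, hsmall 1 one_pos] with t ht ht1
    rw [Real.norm_eq_abs, Real.norm_eq_abs, abs_of_pos (pow_pos ht 4),
      abs_of_nonneg (hrb t ht ht1).1]
    exact (hrb t ht ht1).2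
  have id_pow : ∀ m n : ℕ, m ≤ n → (fun t : ℝ => t ^ n) =O[l] (fun t : ℝ => t ^ m) := by
    intro m n hmn
    refine IsBigO.of_bound 1 ?_
    filter_upwards [hp, hsmall 1 one_pos] with t ht ht1
    rw [one_mul, Real.norm_eq_abs, Real.norm_eq_abs, abs_of_pos (pow_pos ht _),
      abs_of_pos (pow_pos ht _)]
    exact pow_le_pow_of_le_one ht.le ht1 hmn
  have hcont : ∀ g : ℝ → ℝ, Continuous g → g =O[l] (fun _ : ℝ => (1:ℝ)) := by
    intro g hg
    exact ((hg.tendsto 0).mono_left nhdsWithin_le_nhds).isBigO_one ℝ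
  have hP1 : P =O[l] (fun _ : ℝ => (1:ℝ)) := hcont P (by simp only [hP]; fun_prop)
  have hvt : v =O[l] (fun t : ℝ => t) := by
    have hPt : P =O[l] (fun t : ℝ => t) := by
      have h := (isBigO_refl (fun t : ℝ => t) l).mul
        (hcont (fun t => b1 + b2 * t + b3 * t ^ 2) (by fun_prop))
      simp only [mul_one] at h
      refine h.congr_left (fun t => ?_)
      simp only [hP]; ring
    have h := (h3.trans (by simpa using id_pow 1 4 (by norm_num))).add hPt
    simpa using h
  have hv1 : v =O[l] (fun _ : ℝ => (1:ℝ)) := hvt.trans (hcont (fun t => t) continuous_id)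
  have h2 : (fun t => Real.log (1 + v t) - (v t - v t ^ 2 / 2 + v t ^ 3 / 3)) =O[l]
      (fun t : ℝ => t ^ 4) := by
    refine IsBigO.trans ?_ (hvt.pow 4)
    have hvlim : Tendsto v l (nhds 0) :=
      hvt.trans_tendsto ((continuous_id.tendsto (0:ℝ)).mono_left nhdsWithin_le_nhds)
    refine IsBigO.of_bound 2 ?_
    filter_upwards [hp, hsmall 1 one_pos,
      hvlim.eventually_le_const (show (0:ℝ) < 1 / 2 by norm_num)] with t ht ht1 hvt2
    have hv0 : 0 ≤ v t := by
      have h := (hrb t ht ht1).1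
      have : 0 ≤ P t := by
        have e1 := (div_pos (hpos 1) (hpos 0)).le
        have e2 := (div_pos (hpos 2) (hpos 0)).le
        have e3 := (div_pos (hpos 3) (hpos 0)).le
        simp only [hP]; positivity
      linarith
    rw [Real.norm_eq_abs, Real.norm_eq_abs, abs_of_nonneg (pow_nonneg hv0 4)]
    exact log_one_add_cubic hv0 hvt2
  have h4 : (fun t => v t ^ 2 - P t ^ 2) =O[l] (fun t : ℝ => t ^ 4) := by
    have h := h3.mul (hv1.add hP1)
    simp only [mul_one] at h
    exact h.congr_left (fun t => by ring)
  have h5 : (fun t => v t ^ 3 - P t ^ 3) =O[l] (fun t : ℝ => t ^ 4) := by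
    have h := h3.mul (((hv1.mul hv1).add (hv1.mul hP1)).add (hP1.mul hP1))
    simp only [mul_one] at h
    exact h.congr_left (fun t => by ring)
  have h6 : (fun t => (P t - P t ^ 2 / 2 + P t ^ 3 / 3) -
      (b1 * t + (b2 - b1 ^ 2 / 2) * t ^ 2 + (b3 - b1 * b2 + b1 ^ 3 / 3) * t ^ 3)) =O[l]
      (fun t : ℝ => t ^ 4) := by
    have h := (isBigO_refl (fun t : ℝ => t ^ 4) l).mul
        (hcont (fun t => -(b2 ^ 2 + 2 * b1 * b3) / 2 - b2 * b3 * t - b3 ^ 2 / 2 * t ^ 2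
          + b1 ^ 2 * (b2 + b3 * t) + b1 * t * (b2 + b3 * t) ^ 2 +
          t ^ 2 * (b2 + b3 * t) ^ 3 / 3) (by fun_prop))
    simp only [mul_one] at h
    refine h.congr_left (fun t => ?_)
    simp only [hP]; ring
  have h7 : (fun t => ((β - S) * t + ∑' k, Real.log (1 + t * y k)) - Real.log (1 + v t)) =O[l]
      (fun t : ℝ => t ^ 4) := by
    refine IsBigO.of_bound 1 ?_
    filter_upwards [hp] with t ht
    rw [← hlog t ht.le]
    have : 1 + v t = (∑' j : ℕ, a j * t ^ j) / a 0 := by simp only [hv]; ring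
    rw [this, sub_self, norm_zero]
    positivity
  have hfinal : (fun t : ℝ => (b1 - β) * t + (b2 - b1 ^ 2 / 2 + p2 / 2) * t ^ 2 +
      (b3 - b1 * b2 + b1 ^ 3 / 3 - p3 / 3) * t ^ 3) =O[l] (fun t : ℝ => t ^ 4) := by
    have h := ((((h1.sub h7).sub h2).sub h3).add (h4.const_mul_left (1 / 2))).sub
      (h5.const_mul_left (1 / 3))
    have h' := h.sub h6
    refine h'.congr_left (fun t => ?_)
    ring
  obtain ⟨e1, e2, e3⟩ := cubic_coeff_zero _ _ _ hfinal
  refine ⟨by linarith, by linarith, by linarith⟩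

/-- An entire function with positive coefficients and non-decreasing second quotients which
belongs to the Laguerre–Pólya class has `q₂ ≥ 3` and a zero in `[-a₁/a₂, 0)`. -/
lemma LP_zero (a : ℕ → ℝ) (hpos : ∀ k, 0 < a k)
    (hs : ∀ x : ℝ, Summable fun k : ℕ => a k * x ^ k)
    (hq : a 1 ^ 2 / (a 0 * a 2) ≤ a 2 ^ 2 / (a 1 * a 3))
    (hLP : LaguerrePolya (fun x : ℝ => ∑' k : ℕ, a k * x ^ k)) :
    3 ≤ a 1 ^ 2 / (a 0 * a 2) ∧
    ∃ t : ℝ, 0 < t ∧ t ≤ a 1 / a 2 ∧ ∑' j : ℕ, a j * (-t) ^ j = 0 := by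
  obtain ⟨I, y, β, hy0, hys, hle, hz, hlog⟩ := LP_normal_form a hpos hs hLP
  obtain ⟨hy2, hy3, hβ, hp2, hp3⟩ := power_sums a hpos hs y β hy0 hys hle hlog
  have a0 := hpos 0
  have a1 := hpos 1
  have a2 := hpos 2
  have a3 := hpos 3
  set p2 := ∑' k, y k ^ 2
  set p3 := ∑' k, y k ^ 3
  set q := a 1 ^ 2 / (a 0 * a 2) with hqd
  set r := a 2 ^ 2 / (a 1 * a 3) with hrd
  have hβ0 : 0 < β := by rw [hβ]; positivity
  have hq0 : 0 < q := by positivity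
  have hr0 : 0 < r := by positivity
  have e2 : a 2 / a 0 = β ^ 2 / q := by rw [hβ, hqd]; field_simp
  have e3 : a 3 / a 0 = β ^ 3 / (q ^ 2 * r) := by rw [hβ, hqd, hrd]; field_simp
  rw [e2, ← hβ] at hp2
  rw [e2, e3, ← hβ] at hp3
  have hp2n : 0 ≤ p2 := tsum_nonneg (fun k => by positivity)
  have hq2 : 2 ≤ q := by
    rw [hp2] at hp2n
    have : β ^ 2 - 2 * (β ^ 2 / q) = β ^ 2 * (q - 2) / q := by field_simp
    rw [this] at hp2n
    by_contra hlt
    push Not at hlt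
    have : β ^ 2 * (q - 2) / q < 0 := by
      apply div_neg_of_neg_of_pos _ hq0
      have : 0 < β ^ 2 := by positivity
      nlinarith
    linarith
  have hCS : p2 ^ 2 ≤ β * p3 := by
    have hl : ∀ s : ℝ, 0 ≤ p3 - 2 * s * p2 + s ^ 2 * ∑' k, y k := by
      intro s
      have hsum := (hy3.hasSum.sub (hy2.hasSum.mul_left (2 * s))).add
        (hys.hasSum.mul_left (s ^ 2))
      refine hsum.nonneg (fun k => ?_)
      have : y k ^ 3 - 2 * s * y k ^ 2 + s ^ 2 * y k = y k * (y k - s) ^ 2 := by ring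
      rw [this]
      exact mul_nonneg (hy0 k).le (sq_nonneg _)
    have h := hl (p2 / β)
    have h' : 0 ≤ p3 - 2 * (p2 / β) * p2 + (p2 / β) ^ 2 * β := by
      have := mul_le_mul_of_nonneg_left hle (sq_nonneg (p2 / β))
      linarith
    have e : p3 - 2 * (p2 / β) * p2 + (p2 / β) ^ 2 * β = (β * p3 - p2 ^ 2) / β := by
      field_simp; ring
    rw [e] at h'
    rw [le_div_iff₀ hβ0, zero_mul] at h'
    linarith
  have hCS2 : 4 ≤ q + 3 / r := by
    have e : β * p3 - p2 ^ 2 = β ^ 4 / q ^ 2 * (q + 3 / r - 4) := by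
      rw [hp2, hp3]; field_simp; ring
    have h : 0 ≤ β ^ 4 / q ^ 2 * (q + 3 / r - 4) := by linarith
    have hc : 0 < β ^ 4 / q ^ 2 := by positivity
    have := nonneg_of_mul_nonneg_right h hc
    linarith
  have hq3 : 3 ≤ q := by
    have h1 : 3 / r ≤ 3 / q := by
      apply div_le_div_of_nonneg_left (by norm_num) hq0 hq
    have h2 : 4 ≤ q + 3 / q := by linarith
    have h3 : 4 * q ≤ q * q + 3 := by
      have := mul_le_mul_of_nonneg_right h2 hq0.le
      have e : (q + 3 / q) * q = q * q + 3 := by field_simp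
      linarith
    nlinarith
  refine ⟨hq3, ?_⟩
  have hp2pos : 0 < p2 := by
    rw [hp2]
    have : β ^ 2 - 2 * (β ^ 2 / q) = β ^ 2 * (q - 2) / q := by field_simp
    rw [this]
    have : 0 < q - 2 := by linarith
    positivity
  have hR : a 1 / a 2 = q / β := by rw [hβ, hqd]; field_simp
  by_contra hno
  have hlt : ∀ k, y k < β / q := by
    intro k
    by_contra hk
    push Not at hk
    apply hno
    refine ⟨1 / y k, one_div_pos.mpr (hy0 k), ?_, hz k⟩
    rw [hR, div_le_div_iff₀ (hy0 k) hβ0]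
    rw [div_le_iff₀ hq0] at hk
    linarith
  have hsum := (hy2.hasSum.mul_left (β / q)).sub hy3.hasSum
  have hnn : ∀ k, 0 < β / q * y k ^ 2 - y k ^ 3 := by
    intro k
    have : β / q * y k ^ 2 - y k ^ 3 = y k ^ 2 * (β / q - y k) := by ring
    rw [this]
    exact mul_pos (pow_pos (hy0 k) 2) (by linarith [hlt k])
  have hne : Nonempty I := by
    by_contra hemp
    rw [not_nonempty_iff] at hemp
    have : p2 = 0 := tsum_empty
    linarith
  obtain ⟨k0⟩ := hne
  have hstrict : 0 < β / q * p2 - p3 := by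
    have := hsum.summable.tsum_pos (fun k => (hnn k).le) k0 (hnn k0)
    rw [hsum.tsum_eq] at this
    exact this
  have e : β / q * p2 - p3 = -(β ^ 3 / q ^ 2) * (q ^ 2 - 4 * q + 2 + 3 / r) := by
    rw [hp2, hp3]; field_simp; ring
  have hc : 0 < β ^ 3 / q ^ 2 := by positivity
  have : 0 ≤ q ^ 2 - 4 * q + 2 + 3 / r := by nlinarith
  rw [e] at hstrict
  nlinarith
/-! ### Part B: comparison with the partial theta function -/

lemma alt_tsum_ge {d : ℕ → ℝ} (hd : Antitone d) (hs : Summable d) :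
    d 0 - d 1 ≤ ∑' k : ℕ, (-1) ^ k * d k := by
  have := hd.alternating_series_le_tendsto hs.tendsto_alternating_series_tsum 1
  simp only [Finset.sum_range_succ, Finset.sum_range_zero, mul_one] at this
  norm_num at this
  linarith

lemma alt_fin_nonneg (N : ℕ) : ∀ d : ℕ → ℝ, Antitone d → (∀ k, 0 ≤ d k) →
    0 ≤ ∑ k ∈ Finset.range N, (-1) ^ k * d k := by
  induction N using Nat.twoStepInduction with
  | zero => intro d _ _; simp
  | one => intro d _ h; simpa using h 0
  | more n ih _ =>
    intro d hd h0
    rw [Finset.sum_range_succ', Finset.sum_range_succ']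
    have := ih (fun k => d (k + 2)) (fun i j hij => hd (by omega)) (fun k => h0 _)
    have e : ∑ k ∈ Finset.range n, (-1 : ℝ) ^ (k + 1 + 1) * d (k + 1 + 1) =
        ∑ k ∈ Finset.range n, (-1) ^ k * d (k + 2) := by
      refine Finset.sum_congr rfl (fun k _ => ?_)
      rw [pow_add, pow_add]; ring
    rw [e]
    have h1 := hd (show 0 ≤ 1 by norm_num)
    simp only [zero_add, pow_one, pow_zero]
    linarith

lemma compare_key {X ρ w : ℝ} (hX : 1 ≤ X) (hρ : 1 ≤ ρ) (hρX : ρ ≤ X ^ 2) (hw : 0 ≤ w)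
    (hw3 : w ≤ 1 / 3) : X * w - w / ρ ≤ X - 1 := by
  have h1 : w / X ^ 2 ≤ w / ρ := div_le_div_of_nonneg_left hw (by linarith) hρX
  have h2 : X * w - w / X ^ 2 ≤ X - 1 := by
    have e : X * w - w / X ^ 2 = w * (X ^ 3 - 1) / X ^ 2 := by field_simp
    rw [e, div_le_iff₀ (by positivity)]
    have h3 : X ^ 3 - 1 ≤ 3 * ((X - 1) * X ^ 2) := by nlinarith [sq_nonneg (X - 1)]
    have h4 : 0 ≤ X ^ 3 - 1 := by
      have := one_le_pow₀ hX (n := 3); linarith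
    nlinarith
  linarith

lemma compare_theta (b C Q : ℕ → ℝ) (c t : ℝ) (hb : ∀ k, 0 < b k) (hC : ∀ k, 0 < C k)
    (hb0 : b 0 = 1) (hb1 : b 1 = 1) (hC0 : C 0 = 1) (hCs : ∀ k, C (k + 1) = C k * c ^ k)
    (hQ : ∀ k, Q k * (b k * b (k + 2)) = b (k + 1) ^ 2) (hQm : Monotone Q) (hQ3 : 3 ≤ Q 0)
    (hQc : ∀ k, Q k ≤ c) (ht : 0 < t) (htQ : t ≤ Q 0)
    (hs : Summable fun k => b k * t ^ k) :
    ∑' k : ℕ, (-t) ^ k / C k ≤ ∑' k : ℕ, b k * (-t) ^ k := by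
  have hQp : ∀ k, 3 ≤ Q k := fun k => hQ3.trans (hQm (Nat.zero_le k))
  have hc : 3 ≤ c := (hQp 0).trans (hQc 0)
  have hc0 : 0 < c := by linarith
  set X : ℕ → ℝ := fun k => C k * b k with hX
  set ρ : ℕ → ℝ := fun k => c ^ k * b (k + 1) / b k with hρ
  set R : ℕ → ℝ := fun k => c / Q k with hR
  have hXs : ∀ k, X (k + 1) = X k * ρ k := by
    intro k
    have := (hb k).ne'
    simp only [hX, hρ, hCs]; field_simp
  have hρs : ∀ k, ρ (k + 1) = ρ k * R k := by
    intro k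
    have h0 := hb k
    have h1 := hb (k + 1)
    have h2 := hb (k + 2)
    have hq : 0 < Q k := by linarith [hQp k]
    have h := hQ k
    simp only [hR, hρ]
    rw [show k + 1 + 1 = k + 2 from rfl, pow_succ]
    field_simp
    linarith
  have hR1 : ∀ k, 1 ≤ R k := fun k => by
    have : 0 < Q k := by linarith [hQp k]
    simp only [hR]; rw [le_div_iff₀ this]; linarith [hQc k]
  have hR0 : ∀ k, R k ≤ R 0 := fun k => by
    simp only [hR]
    exact div_le_div_of_nonneg_left hc0.le (by linarith) (hQm (Nat.zero_le k))
  have hX0 : X 0 = 1 := by simp [hX, hb0, hC0]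
  have hρ0 : ρ 0 = 1 := by simp [hρ, hb0, hb1]
  have hX1 : X 1 = 1 := by rw [hXs 0, hX0, hρ0, one_mul]
  have hρ1 : ρ 1 = R 0 := by rw [hρs 0, hρ0, one_mul]
  have hX2 : X 2 = R 0 := by rw [hXs 1, hX1, hρ1, one_mul]
  have hρ2 : ρ 2 = R 0 * R 1 := by rw [hρs 1, hρ1]
  have hind : ∀ m, 1 ≤ X (m + 2) ∧ R 0 ≤ ρ (m + 2) ∧ ρ (m + 2) ≤ X (m + 2) ^ 2 := by
    intro m
    induction m with
    | zero =>
      simp only [zero_add]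
      rw [hX2, hρ2]
      refine ⟨hR1 0, by nlinarith [hR1 0, hR1 1], by nlinarith [hR1 0, hR0 1]⟩
    | succ m ih =>
      obtain ⟨i1, i2, i3⟩ := ih
      have e1 : X (m + 1 + 2) = X (m + 2) * ρ (m + 2) := hXs (m + 2)
      have e2 : ρ (m + 1 + 2) = ρ (m + 2) * R (m + 2) := hρs (m + 2)
      rw [e1, e2]
      have r1 := hR1 0
      have r2 := hR1 (m + 2)
      have r3 := hR0 (m + 2)
      have hρ1' : 1 ≤ ρ (m + 2) := r1.trans i2
      refine ⟨by nlinarith, by nlinarith, ?_⟩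
      have s1 : ρ (m + 2) * R (m + 2) ≤ ρ (m + 2) ^ 2 := by nlinarith
      have s2 : ρ (m + 2) ^ 2 ≤ (X (m + 2) * ρ (m + 2)) ^ 2 := by
        apply pow_le_pow_left₀ (by linarith); nlinarith
      linarith
  have hXge : ∀ k, 1 ≤ X k := by
    intro k
    match k with
    | 0 => exact hX0.ge
    | 1 => exact hX1.ge
    | m + 2 => exact (hind m).1
  have hw : ∀ m, t * b (m + 3) / b (m + 2) ≤ 1 / 3 := by
    intro m
    induction m with
    | zero =>
      have h0 := hQ 0
      have h1 := hQ 1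
      simp only [zero_add] at h0 h1 ⊢
      norm_num at h0 h1
      rw [hb0, hb1] at h0
      rw [hb1] at h1
      have b2 := hb 2
      have b3 := hb 3
      rw [div_le_iff₀ b2]
      have q1 := hQp 1
      have s1 : t * b 2 ≤ 1 := by nlinarith
      have s2 : 3 * b 3 ≤ b 2 ^ 2 := by nlinarith
      nlinarith
    | succ m ih =>
      have h := hQ (m + 2)
      have b2 := hb (m + 2)
      have b3 := hb (m + 3)
      have b4 := hb (m + 4)
      rw [show m + 2 + 1 = m + 3 from rfl, show m + 2 + 2 = m + 4 from rfl] at h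
      rw [show m + 1 + 3 = m + 4 from rfl, show m + 1 + 2 = m + 3 from rfl]
      rw [div_le_iff₀ b2] at ih
      rw [div_le_iff₀ b3]
      have q1 := hQp (m + 2)
      have s2 : b (m + 2) * b (m + 4) ≤ b (m + 3) ^ 2 := by
        have : 0 < b (m + 2) * b (m + 4) := mul_pos b2 b4
        nlinarith
      have s3 : b (m + 2) * (t * b (m + 4)) ≤ b (m + 2) * (1 / 3 * b (m + 3)) := by
        calc b (m + 2) * (t * b (m + 4)) = t * (b (m + 2) * b (m + 4)) := by ring
          _ ≤ t * b (m + 3) ^ 2 := mul_le_mul_of_nonneg_left s2 ht.le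
          _ = (t * b (m + 3)) * b (m + 3) := by ring
          _ ≤ (1 / 3 * b (m + 2)) * b (m + 3) := mul_le_mul_of_nonneg_right ih b3.le
          _ = _ := by ring
      exact le_of_mul_le_mul_left s3 b2
  set d : ℕ → ℝ := fun k => t ^ k * (b k - 1 / C k) with hd
  have hinv : ∀ k, 1 / C k ≤ b k := by
    intro k
    rw [div_le_iff₀ (hC k)]
    have := hXge k
    simp only [hX] at this
    linarith
  have hsC : Summable (fun k => t ^ k / C k) := by
    refine Summable.of_nonneg_of_le (fun k => div_nonneg (pow_nonneg ht.le k) (hC k).le) ?_ hs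
    intro k
    have := mul_le_mul_of_nonneg_right (hinv k) (pow_nonneg ht.le k)
    calc t ^ k / C k = 1 / C k * t ^ k := by ring
      _ ≤ _ := this
  have hds : Summable d := by
    refine (hs.sub hsC).congr (fun k => ?_)
    simp only [hd]; ring
  have hd0 : d 0 = 0 := by simp [hd, hb0, hC0]
  have hC1 : C 1 = 1 := by rw [hCs 0, hC0]; simp
  have hd1 : d 1 = 0 := by simp [hd, hb1, hC1]
  have hanti : Antitone (fun m => d (m + 2)) := by
    refine antitone_nat_of_succ_le (fun m => ?_)
    obtain ⟨i1, i2, i3⟩ := hind m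
    have h := compare_key i1 ((hR1 0).trans i2) i3
      (div_nonneg (mul_nonneg ht.le (hb (m + 3)).le) (hb (m + 2)).le) (hw m)
    have b2 := hb (m + 2)
    have b3 := hb (m + 3)
    have C2 := hC (m + 2)
    have e : d (m + 1 + 2) = t ^ (m + 2) / C (m + 2) *
        (X (m + 2) * (t * b (m + 3) / b (m + 2)) - t * b (m + 3) / b (m + 2) / ρ (m + 2)) := by
      simp only [hd, hX, hρ]
      rw [show m + 1 + 2 = (m + 2) + 1 by ring, hCs (m + 2),
        show m + 2 + 1 = m + 3 from rfl]
      have : t ^ (m + 3) = t ^ (m + 2) * t := pow_succ t (m + 2)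
      rw [this]
      field_simp
    have e' : d (m + 2) = t ^ (m + 2) / C (m + 2) * (X (m + 2) - 1) := by
      simp only [hd, hX]
      field_simp
    rw [e, e']
    exact mul_le_mul_of_nonneg_left h (by positivity)
  have hmain := alt_tsum_ge hanti ((summable_nat_add_iff 2).mpr hds)
  have h01 := hanti (show 0 ≤ 1 by norm_num)
  simp only at h01
  have hnn : 0 ≤ ∑' k : ℕ, (-1) ^ k * d (k + 2) := by linarith
  have halt : Summable (fun k : ℕ => (-1) ^ k * d k) := hds.alternating
  have hsplit := halt.sum_add_tsum_nat_add 2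
  simp only [Finset.sum_range_succ, Finset.sum_range_zero, hd0, hd1] at hsplit
  have e3 : ∑' k : ℕ, (-1 : ℝ) ^ (k + 2) * d (k + 2) = ∑' k : ℕ, (-1) ^ k * d (k + 2) := by
    refine tsum_congr (fun k => ?_)
    rw [pow_add]; ring
  rw [e3] at hsplit
  have hA : Summable (fun k => b k * (-t) ^ k) :=
    hs.alternating.congr (fun k => by rw [neg_pow]; ring)
  have hB : Summable (fun k => (-t) ^ k / C k) :=
    hsC.alternating.congr (fun k => by rw [neg_pow]; ring)
  have hdiff : ∑' k : ℕ, (-1) ^ k * d k = ∑' k, b k * (-t) ^ k - ∑' k, (-t) ^ k / C k := by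
    rw [← hA.tsum_sub hB]
    refine tsum_congr (fun k => ?_)
    simp only [hd]
    rw [neg_pow]; ring
  linarith
/-! ### Part C: the partial theta function with a non-positive value is in the class -/

lemma theta_summable {a : ℝ} (ha : 1 < a) (x : ℝ) : Summable (fun k : ℕ => x ^ k / a ^ (k ^ 2)) := by
  have h1 : Tendsto (fun k : ℕ => |x| / a ^ k) atTop (nhds 0) :=
    Tendsto.div_atTop tendsto_const_nhds (tendsto_pow_atTop_atTop_of_one_lt ha)
  have h2 : ∀ᶠ k : ℕ in atTop, |x| / a ^ k ≤ 1 / 2 := h1.eventually_le_const (by norm_num)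
  refine Summable.of_norm_bounded_eventually_nat (g := fun k : ℕ => (1 / 2 : ℝ) ^ k)
    (summable_geometric_of_lt_one (by norm_num) (by norm_num)) ?_
  filter_upwards [h2] with k hk
  have e : x ^ k / a ^ (k ^ 2) = (x / a ^ k) ^ k := by
    rw [div_pow, ← pow_mul, sq]
  rw [e, norm_pow, norm_div, Real.norm_eq_abs, Real.norm_eq_abs,
    abs_of_pos (pow_pos (by linarith : (0:ℝ) < a) k)]
  exact pow_le_pow_left₀ (by positivity) hk k

/-- Partial sums of the partial theta function. -/
noncomputable def thetaPart (a : ℝ) (n : ℕ) (x : ℝ) : ℝ :=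
  ∑ k ∈ Finset.range (n + 1), x ^ k / a ^ (k ^ 2)

/-- One-sided theta sums. -/
noncomputable def halfTheta (b : ℝ) (r : ℕ) : ℝ :=
  ∑ i ∈ Finset.range (r + 1), (-1) ^ i * b ^ (i ^ 2)

lemma sq_pow_antitone {b : ℝ} (hb0 : 0 ≤ b) (hb1 : b ≤ 1) (s : ℕ) :
    Antitone (fun i : ℕ => b ^ ((i + s) ^ 2)) := by
  intro i j hij
  exact pow_le_pow_of_le_one hb0 hb1 (Nat.pow_le_pow_left (by omega) 2)

lemma halfTheta_ge_one {b : ℝ} (hb0 : 0 ≤ b) (hb1 : b ≤ 1) (r : ℕ) (hr : 1 ≤ r) :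
    1 - b ≤ halfTheta b r := by
  obtain ⟨m, rfl⟩ := Nat.exists_eq_add_of_le' hr
  unfold halfTheta
  rw [Finset.sum_range_succ', Finset.sum_range_succ']
  have h := alt_fin_nonneg m _ (sq_pow_antitone hb0 hb1 2) (fun k => by positivity)
  have e : ∑ k ∈ Finset.range m, (-1 : ℝ) ^ (k + 1 + 1) * b ^ ((k + 1 + 1) ^ 2) =
      ∑ k ∈ Finset.range m, (-1) ^ k * b ^ ((k + 2) ^ 2) := by
    refine Finset.sum_congr rfl (fun k _ => ?_)
    rw [pow_add, pow_add]; ring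
  rw [e]
  norm_num
  linarith

lemma halfTheta_ge_two {b : ℝ} (hb0 : 0 ≤ b) (hb1 : b ≤ 1) (r : ℕ) (hr : 2 ≤ r) :
    1 - b + b ^ 4 - b ^ 9 ≤ halfTheta b r := by
  obtain ⟨m, rfl⟩ := Nat.exists_eq_add_of_le' hr
  rcases Nat.eq_zero_or_pos m with rfl | hm
  · unfold halfTheta
    simp only [Finset.sum_range_succ, Finset.sum_range_zero]
    norm_num
    have := pow_nonneg hb0 9
    linarith
  obtain ⟨l, rfl⟩ := Nat.exists_eq_add_of_le' hm
  unfold halfTheta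
  rw [show l + 1 + 2 + 1 = l + 4 by ring]
  rw [Finset.sum_range_succ', Finset.sum_range_succ', Finset.sum_range_succ',
    Finset.sum_range_succ']
  have h := alt_fin_nonneg l _ (sq_pow_antitone hb0 hb1 4) (fun k => by positivity)
  have e : ∑ k ∈ Finset.range l, (-1 : ℝ) ^ (k + 1 + 1 + 1 + 1) * b ^ ((k + 1 + 1 + 1 + 1) ^ 2) =
      ∑ k ∈ Finset.range l, (-1) ^ k * b ^ ((k + 4) ^ 2) := by
    refine Finset.sum_congr rfl (fun k _ => ?_)
    rw [show k + 1 + 1 + 1 + 1 = k + 4 by ring, pow_add (-1 : ℝ) k 4]; ring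
  rw [e]
  norm_num
  linarith

lemma thetaPart_eval {a : ℝ} (ha : 1 < a) (j l : ℕ) :
    (-1) ^ j * thetaPart a (j + l) (-a ^ (2 * j)) =
      a ^ (j ^ 2) * (halfTheta a⁻¹ j + halfTheta a⁻¹ l - 1) := by
  have ha0 : a ≠ 0 := by positivity
  unfold thetaPart
  rw [add_assoc, Finset.sum_range_add, mul_add]
  have h1 : (-1) ^ j * ∑ i ∈ Finset.range (l + 1), (-a ^ (2 * j)) ^ (j + i) / a ^ ((j + i) ^ 2) =
      a ^ (j ^ 2) * halfTheta a⁻¹ l := by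
    unfold halfTheta
    rw [Finset.mul_sum, Finset.mul_sum]
    refine Finset.sum_congr rfl (fun i _ => ?_)
    rw [neg_pow (a ^ (2 * j)), ← pow_mul, inv_pow, pow_add (-1 : ℝ) j i]
    have hsq : (-1 : ℝ) ^ j * (-1) ^ j = 1 := by rw [← mul_pow]; norm_num
    have e : a ^ (2 * j * (j + i)) * a ^ (i ^ 2) = a ^ (j ^ 2) * a ^ ((j + i) ^ 2) := by
      rw [← pow_add, ← pow_add]; congr 1; ring
    have e' : a ^ (2 * j * (j + i)) / a ^ ((j + i) ^ 2) = a ^ (j ^ 2) * (a ^ (i ^ 2))⁻¹ := by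
      field_simp; linarith
    calc _ = ((-1 : ℝ) ^ j * (-1) ^ j) * (-1) ^ i *
            (a ^ (2 * j * (j + i)) / a ^ ((j + i) ^ 2)) := by ring
      _ = _ := by rw [hsq, e']; ring
  have h2 : (-1) ^ j * ∑ k ∈ Finset.range j, (-a ^ (2 * j)) ^ k / a ^ (k ^ 2) =
      a ^ (j ^ 2) * (halfTheta a⁻¹ j - 1) := by
    unfold halfTheta
    rw [Finset.sum_range_succ', ← Finset.sum_range_reflect]
    simp only [pow_zero, ne_eq, OfNat.ofNat_ne_zero, not_false_eq_true, zero_pow, mul_one,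
      add_sub_cancel_right]
    rw [Finset.mul_sum, Finset.mul_sum]
    refine Finset.sum_congr rfl (fun i hi => ?_)
    rw [Finset.mem_range] at hi
    obtain ⟨m, rfl⟩ : ∃ m, j = m + (i + 1) := ⟨j - (i + 1), by omega⟩
    rw [show m + (i + 1) - 1 - i = m by omega]
    rw [neg_pow (a ^ (2 * (m + (i + 1)))), ← pow_mul, inv_pow, pow_add (-1 : ℝ) m (i + 1)]
    have hsq : (-1 : ℝ) ^ m * (-1) ^ m = 1 := by rw [← mul_pow]; norm_num
    have e : a ^ (2 * (m + (i + 1)) * m) * a ^ ((i + 1) ^ 2) =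
        a ^ ((m + (i + 1)) ^ 2) * a ^ (m ^ 2) := by
      rw [← pow_add, ← pow_add]; congr 1; ring
    have e' : a ^ (2 * (m + (i + 1)) * m) / a ^ (m ^ 2) =
        a ^ ((m + (i + 1)) ^ 2) * (a ^ ((i + 1) ^ 2))⁻¹ := by
      field_simp; linarith
    calc _ = ((-1 : ℝ) ^ m * (-1) ^ m) * (-1) ^ (i + 1) *
            (a ^ (2 * (m + (i + 1)) * m) / a ^ (m ^ 2)) := by ring
      _ = _ := by rw [hsq, e']; ring
  rw [h1, h2]; ring

lemma thetaPart_reflect {a y : ℝ} (ha : 1 < a) (hy : 0 < y) (n : ℕ) :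
    thetaPart a n (-(a ^ (2 * n) / y)) * y ^ n = (-1) ^ n * a ^ (n ^ 2) * thetaPart a n (-y) := by
  have ha0 : a ≠ 0 := by positivity
  unfold thetaPart
  rw [Finset.sum_mul, Finset.mul_sum, ← Finset.sum_range_reflect]
  refine Finset.sum_congr rfl (fun m hm => ?_)
  rw [Finset.mem_range] at hm
  obtain ⟨k, rfl⟩ : ∃ k, n = k + m := ⟨n - m, by omega⟩
  rw [show k + m + 1 - 1 - m = k by omega, neg_pow, neg_pow y, div_pow, ← pow_mul]
  have hsq : (-1 : ℝ) ^ m * (-1) ^ m = 1 := by rw [← mul_pow]; norm_num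
  have e : a ^ (2 * (k + m) * k) * a ^ (m ^ 2) = a ^ ((k + m) ^ 2) * a ^ (k ^ 2) := by
    rw [← pow_add, ← pow_add]; congr 1; ring
  have e' : a ^ (2 * (k + m) * k) / a ^ (k ^ 2) = a ^ ((k + m) ^ 2) / a ^ (m ^ 2) := by
    field_simp; linarith
  have hyk : y ^ k ≠ 0 := by positivity
  have e2 : y ^ (k + m) / y ^ k = y ^ m := by rw [pow_add]; field_simp
  calc _ = (-1 : ℝ) ^ k * (a ^ (2 * (k + m) * k) / a ^ (k ^ 2)) * (y ^ (k + m) / y ^ k) := by ring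
    _ = (-1 : ℝ) ^ k * (a ^ ((k + m) ^ 2) / a ^ (m ^ 2)) * y ^ m := by rw [e', e2]
    _ = ((-1 : ℝ) ^ m * (-1) ^ m) * ((-1 : ℝ) ^ k * (a ^ ((k + m) ^ 2) / a ^ (m ^ 2)) * y ^ m) := by
        rw [hsq, one_mul]
    _ = _ := by rw [pow_add (-1 : ℝ) k m]; ring

lemma theta_const_pos {b : ℝ} (hb0 : 0 ≤ b) (hb : b ^ 2 ≤ 1 / 3) :
    0 < 1 - 2 * b + 2 * b ^ 4 - 2 * b ^ 9 := by
  have h1 : b ≤ 0.5774 := by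
    by_contra h
    push Not at h
    nlinarith
  have h4 : b ^ 4 ≤ 1 / 9 := by
    have : b ^ 4 = (b ^ 2) ^ 2 := by ring
    rw [this]; nlinarith [sq_nonneg b]
  have h5 : b ^ 5 ≤ 0.065 := by
    have : b ^ 5 = b ^ 4 * b := by ring
    rw [this]
    nlinarith [pow_nonneg hb0 4]
  have h9 : b ^ 9 ≤ 0.065 * b ^ 4 := by
    have : b ^ 9 = b ^ 5 * b ^ 4 := by ring
    rw [this]
    exact mul_le_mul_of_nonneg_right h5 (pow_nonneg hb0 4)
  have ht : 2 * (0.577 : ℝ) ^ 2 * b ^ 2 - 0.577 ^ 4 ≤ b ^ 4 := by nlinarith [sq_nonneg (b ^ 2 - 0.577 ^ 2)]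
  have ht2 : 2 * 0.577 * b - 0.577 ^ 2 ≤ b ^ 2 := by nlinarith [sq_nonneg (b - 0.577)]
  norm_num at ht ht2 ⊢
  nlinarith

lemma theta_tail_pos {a τ : ℝ} (ha : 1 < a) (hτ0 : 0 < τ) (hτ3 : τ ≤ a ^ 3) (N : ℕ) (hN : 2 ≤ N) :
    0 < ∑' k : ℕ, (-1) ^ k * (τ ^ (k + N) / a ^ ((k + N) ^ 2)) := by
  have ha0 : 0 < a := by linarith
  have hstep : ∀ k : ℕ, 2 ≤ k → τ ^ (k + 1) / a ^ ((k + 1) ^ 2) < τ ^ k / a ^ (k ^ 2) := by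
    intro k hk
    have e : a ^ ((k + 1) ^ 2) = a ^ (k ^ 2) * a ^ (2 * k + 1) := by
      rw [← pow_add]; congr 1; ring
    have h1 : τ < a ^ (2 * k + 1) := lt_of_le_of_lt hτ3 (pow_lt_pow_right₀ ha (by omega))
    rw [e, pow_succ, div_lt_div_iff₀ (by positivity) (by positivity)]
    have : 0 < τ ^ k * a ^ (k ^ 2) := by positivity
    nlinarith
  have hanti : Antitone (fun k : ℕ => τ ^ (k + N) / a ^ ((k + N) ^ 2)) := by
    refine antitone_nat_of_succ_le (fun k => ?_)
    have := (hstep (k + N) (by omega)).le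
    rwa [show k + N + 1 = k + 1 + N by ring] at this
  have h := alt_tsum_ge hanti ((summable_nat_add_iff N).mpr (theta_summable ha τ))
  have h2 := hstep N hN
  simp only [zero_add] at h
  rw [add_comm 1 N] at h
  linarith

lemma theta_split {a τ : ℝ} (ha : 1 < a) (N : ℕ) (hN : Even N) :
    ∑' k : ℕ, (-τ) ^ k / a ^ (k ^ 2) = ∑ k ∈ Finset.range N, (-τ) ^ k / a ^ (k ^ 2) +
      ∑' k : ℕ, (-1) ^ k * (τ ^ (k + N) / a ^ ((k + N) ^ 2)) := by
  rw [← (theta_summable ha (-τ)).sum_add_tsum_nat_add N]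
  congr 1
  refine tsum_congr (fun k => ?_)
  rw [neg_pow, pow_add (-1 : ℝ), hN.neg_one_pow]; ring

lemma theta_tau_gt {a τ : ℝ} (ha : 1 < a) (hτ0 : 0 < τ) (hτ3 : τ ≤ a ^ 3)
    (hg : ∑' k : ℕ, (-τ) ^ k / a ^ (k ^ 2) ≤ 0) : a < τ := by
  by_contra hlt
  push Not at hlt
  have h1 := theta_tail_pos ha hτ0 hτ3 2 le_rfl
  rw [theta_split ha 2 even_two] at hg
  simp only [Finset.sum_range_succ, Finset.sum_range_zero] at hg
  norm_num at hg
  have : τ / a ≤ 1 := by rw [div_le_one (by linarith)]; exact hlt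
  have e : -τ / a = -(τ / a) := by ring
  rw [e] at hg
  linarith

lemma theta_part_neg {a τ : ℝ} (ha : 1 < a) (hτ0 : 0 < τ) (hτ3 : τ ≤ a ^ 3)
    (hg : ∑' k : ℕ, (-τ) ^ k / a ^ (k ^ 2) ≤ 0) (n : ℕ) (hn : Odd n) (hn1 : 1 ≤ n) :
    thetaPart a n (-τ) < 0 := by
  have h1 := theta_tail_pos ha hτ0 hτ3 (n + 1) (by omega)
  rw [theta_split ha (n + 1) hn.add_one] at hg
  unfold thetaPart
  linarith

lemma exists_roots (F : ℝ → ℝ) (hF : Continuous F) (Y : ℕ → ℝ) (n : ℕ)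
    (hY : ∀ j, j < n → Y j < Y (j + 1)) (hs : ∀ j, j ≤ n → 0 < (-1) ^ j * F (Y j)) :
    ∃ z : ℕ → ℝ, ∀ j, j < n → Y j < z j ∧ z j < Y (j + 1) ∧ F (z j) = 0 := by
  have h : ∀ j, ∃ z, j < n → Y j < z ∧ z < Y (j + 1) ∧ F z = 0 := by
    intro j
    by_cases hj : j < n
    · have h1 := hs j hj.le
      have h2 := hs (j + 1) hj
      have hcont : ContinuousOn (fun x => (-1) ^ j * F x) (Set.Icc (Y j) (Y (j + 1))) := by
        fun_prop
      have hiv := intermediate_value_Ioo' (hY j hj).le hcont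
      have h3 : (-1) ^ j * F (Y (j + 1)) < 0 := by rw [pow_succ] at h2; linarith
      obtain ⟨z, hz, hz0⟩ := hiv ⟨h3, h1⟩
      refine ⟨z, fun _ => ⟨hz.1, hz.2, ?_⟩⟩
      simp only at hz0
      rcases mul_eq_zero.mp hz0 with h0 | h0
      · exact absurd h0 (pow_ne_zero _ (by norm_num))
      · exact h0
    · exact ⟨0, fun h => absurd h hj⟩
  choose z hz using h
  exact ⟨z, hz⟩

open Polynomial in
lemma thetaPart_factor (a : ℝ) (n : ℕ) (z : ℕ → ℝ) (hzp : ∀ j, j < n → 0 < z j)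
    (hinj : ∀ i j, i < j → j < n → z i < z j)
    (hz : ∀ j, j < n → thetaPart a n (-z j) = 0) (x : ℝ) :
    thetaPart a n x = ∏ j ∈ Finset.range n, (1 + x * (z j)⁻¹) := by
  set p : ℝ[X] := ∑ k ∈ Finset.range (n + 1), C (1 / a ^ (k ^ 2)) * X ^ k with hp
  set r : ℝ[X] := ∏ j ∈ Finset.range n, (1 + C ((z j)⁻¹) * X) with hr
  have hpe : ∀ x, p.eval x = thetaPart a n x := by
    intro x
    simp only [hp, thetaPart, eval_finsetSum, eval_mul, eval_C, eval_pow, eval_X]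
    refine Finset.sum_congr rfl (fun k _ => by ring)
  have hre : ∀ x, r.eval x = ∏ j ∈ Finset.range n, (1 + x * (z j)⁻¹) := by
    intro x
    simp only [hr, eval_prod, eval_add, eval_one, eval_mul, eval_C, eval_X]
    refine Finset.prod_congr rfl (fun k _ => by ring)
  have hpd : p.degree < ((n + 1 : ℕ) : WithBot ℕ) := by
    refine (degree_sum_le _ _).trans_lt ?_
    rw [Finset.sup_lt_iff (WithBot.bot_lt_coe _)]
    intro k hk
    refine (degree_C_mul_X_pow_le _ _).trans_lt ?_
    exact_mod_cast Finset.mem_range.mp hk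
  have hrd : r.degree < ((n + 1 : ℕ) : WithBot ℕ) := by
    have h1 : r.natDegree ≤ n := by
      refine (natDegree_prod_le _ _).trans ?_
      refine (Finset.sum_le_card_nsmul _ _ 1 (fun j _ => ?_)).trans (by simp)
      refine (natDegree_add_le _ _).trans ?_
      simp only [natDegree_one]
      refine max_le (by norm_num) ?_
      exact (natDegree_C_mul_le _ _).trans natDegree_X_le
    refine lt_of_le_of_lt degree_le_natDegree ?_
    exact_mod_cast Nat.lt_succ_of_le h1
  set v : ℕ → ℝ := fun i => if i < n then -z i else 0 with hv
  have hvinj : Set.InjOn v (Finset.range (n + 1) : Set ℕ) := by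
    have key : ∀ i j, i < j → j < n + 1 → v i ≠ v j := by
      intro i j hij hj
      have hi : i < n := by omega
      simp only [hv, if_pos hi]
      split_ifs with hjn
      · have := hinj i j hij hjn
        intro h; linarith
      · have := hzp i hi
        intro h; linarith
    intro i hi j hj hij
    simp only [Finset.coe_range, Set.mem_Iio] at hi hj
    rcases lt_trichotomy i j with h | h | h
    · exact absurd hij (key i j h hj)
    · exact h
    · exact absurd hij.symm (key j i h hi)
  have hpr : p = r := by
    refine eq_of_degrees_lt_of_eval_index_eq (v := v) (Finset.range (n + 1)) hvinj
      (by simpa using hpd) (by simpa using hrd) ?_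
    intro i hi
    rw [Finset.mem_range] at hi
    rw [hpe, hre]
    simp only [hv]
    split_ifs with hin
    · rw [hz i hin]
      symm
      apply Finset.prod_eq_zero (Finset.mem_range.mpr hin)
      have := (hzp i hin).ne'
      field_simp; ring
    · simp only [zero_mul, add_zero, Finset.prod_const_one, thetaPart]
      rw [Finset.sum_eq_single 0]
      · simp
      · intro b _ hb; simp [hb]
      · simp
  rw [← hpe, hpr, hre]

lemma thetaPart_real_rooted {a τ : ℝ} (ha3 : 3 ≤ a ^ 2) (ha : 1 < a) (hτ0 : 0 < τ)
    (hτ3 : τ ≤ a ^ 3)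
    (hg : ∑' k : ℕ, (-τ) ^ k / a ^ (k ^ 2) ≤ 0) (n : ℕ) (hn : Odd n) (hn5 : 5 ≤ n) :
    ∃ w : ℕ → ℝ, (∀ j, 0 ≤ w j ∧ w j ≤ a⁻¹ ^ j) ∧
      ∀ x, thetaPart a n x = ∏' j, (1 + x * w j) := by
  have ha0 : 0 < a := by linarith
  have hτa := theta_tau_gt ha hτ0 hτ3 hg
  have hb0 : 0 ≤ a⁻¹ := by positivity
  have hb1 : a⁻¹ < 1 := inv_lt_one_of_one_lt₀ ha
  have hb3 : a⁻¹ ^ 2 ≤ 1 / 3 := by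
    rw [inv_pow, ← one_div]
    exact one_div_le_one_div_of_le (by norm_num) ha3
  set Y : ℕ → ℝ := fun j => if j = 1 then τ else if j = n - 1 then a ^ (2 * n) / τ
    else a ^ (2 * j) with hY
  have hY1 : Y 1 = τ := by simp [hY]
  have hYn1 : Y (n - 1) = a ^ (2 * n) / τ := by
    simp only [hY]; rw [if_neg (by omega)]; simp
  have hYj : ∀ j, j ≠ 1 → j ≠ n - 1 → Y j = a ^ (2 * j) := by
    intro j h1 h2
    simp only [hY]; rw [if_neg h1, if_neg h2]
  have hrefl_lo : a ^ (2 * n - 3) ≤ a ^ (2 * n) / τ := by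
    rw [le_div_iff₀ hτ0]
    calc a ^ (2 * n - 3) * τ ≤ a ^ (2 * n - 3) * a ^ 3 :=
          mul_le_mul_of_nonneg_left hτ3 (by positivity)
      _ = a ^ (2 * n) := by rw [← pow_add]; congr 1; omega
  have hrefl_hi : a ^ (2 * n) / τ < a ^ (2 * n) := by
    apply div_lt_self (by positivity); linarith
  have hYlo : ∀ j, a ^ j ≤ Y j := by
    intro j
    by_cases h1 : j = 1
    · subst h1; rw [hY1, pow_one]; exact hτa.le
    by_cases h2 : j = n - 1
    · subst h2
      rw [hYn1]
      refine le_trans ?_ hrefl_lo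
      exact pow_le_pow_right₀ ha.le (by omega)
    · rw [hYj j h1 h2]
      exact pow_le_pow_right₀ ha.le (by omega)
  have hYmono : ∀ j, j < n → Y j < Y (j + 1) := by
    intro j hj
    by_cases h0 : j = 0
    · subst h0
      rw [hYj 0 (by omega) (by omega)]
      simp only [mul_zero, pow_zero, zero_add, hY1]
      linarith
    by_cases h1 : j = 1
    · subst h1
      rw [hY1, hYj 2 (by omega) (by omega)]
      exact lt_of_le_of_lt hτ3 (pow_lt_pow_right₀ ha (by norm_num))
    by_cases h2 : j = n - 1
    · rw [h2, hYn1, show n - 1 + 1 = n by omega, hYj n (by omega) (by omega)]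
      exact hrefl_hi
    by_cases h3 : j + 1 = n - 1
    · rw [h3, hYn1, hYj j h1 h2]
      refine lt_of_lt_of_le ?_ hrefl_lo
      exact pow_lt_pow_right₀ ha (by omega)
    · rw [hYj j h1 h2, hYj (j + 1) (by omega) h3]
      exact pow_lt_pow_right₀ ha (by omega)
  have hsign : ∀ j, j ≤ n → 0 < (-1) ^ j * thetaPart a n (-Y j) := by
    intro j hj
    have hneg := theta_part_neg ha hτ0 hτ3 hg n hn (by omega)
    by_cases h1 : j = 1
    · subst h1; rw [hY1]; linarith
    by_cases h2 : j = n - 1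
    · rw [h2, hYn1]
      have hr := thetaPart_reflect ha hτ0 n
      rw [hn.neg_one_pow] at hr
      have heven : Even (n - 1) := by
        obtain ⟨k, hk⟩ := hn
        exact ⟨k, by omega⟩
      rw [heven.neg_one_pow, one_mul]
      have hpos : 0 < thetaPart a n (-(a ^ (2 * n) / τ)) * τ ^ n := by
        rw [hr]
        have : 0 < a ^ (n ^ 2) := by positivity
        nlinarith
      exact pos_of_mul_pos_left hpos (by positivity)
    · rw [hYj j h1 h2]
      obtain ⟨l, rfl⟩ := Nat.exists_eq_add_of_le hj
      rw [thetaPart_eval ha j l]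
      refine mul_pos (by positivity) ?_
      have hz : halfTheta a⁻¹ 0 = 1 := by simp [halfTheta]
      by_cases h0 : j = 0
      · subst h0
        have := halfTheta_ge_one hb0 hb1.le l (by omega)
        rw [hz]; linarith
      by_cases hl : l = 0
      · subst hl
        have := halfTheta_ge_one hb0 hb1.le j (by omega)
        rw [hz]; linarith
      · have e1 := halfTheta_ge_two hb0 hb1.le j (by omega)
        have e2 := halfTheta_ge_two hb0 hb1.le l (by omega)
        have e3 := theta_const_pos hb0 hb3
        linarith
  have hcont : Continuous (fun y => thetaPart a n (-y)) := by
    unfold thetaPart; fun_prop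
  obtain ⟨z, hz⟩ := exists_roots (fun y => thetaPart a n (-y)) hcont Y n hYmono hsign
  have hzlo : ∀ j, j < n → a ^ j ≤ z j := fun j hj => (hYlo j).trans (hz j hj).1.le
  have hzp : ∀ j, j < n → 0 < z j := fun j hj => lt_of_lt_of_le (by positivity) (hzlo j hj)
  have hYle : ∀ i j, i ≤ j → j ≤ n → Y i ≤ Y j := by
    intro i j hij
    induction j, hij using Nat.le_induction with
    | base => intro _; exact le_rfl
    | succ m _ ih => intro hm; exact (ih (by omega)).trans (hYmono m (by omega)).le
  have hinj : ∀ i j, i < j → j < n → z i < z j := by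
    intro i j hij hj
    exact (hz i (by omega)).2.1.trans
      (lt_of_le_of_lt (hYle (i + 1) j (by omega) (by omega)) (hz j hj).1)
  refine ⟨fun j => if j < n then (z j)⁻¹ else 0, ?_, ?_⟩
  · intro j
    dsimp only
    split_ifs with hj
    · refine ⟨(inv_pos.mpr (hzp j hj)).le, ?_⟩
      rw [inv_pow]
      exact inv_anti₀ (by positivity) (hzlo j hj)
    · exact ⟨le_rfl, by positivity⟩
  · intro x
    rw [thetaPart_factor a n z hzp hinj (fun j hj => (hz j hj).2.2) x]
    rw [tprod_eq_prod (s := Finset.range n)]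
    · refine Finset.prod_congr rfl (fun j hj => ?_)
      dsimp only
      rw [if_pos (Finset.mem_range.mp hj)]
    · intro j hj
      rw [Finset.mem_range] at hj
      dsimp only
      rw [if_neg hj, mul_zero, add_zero]

lemma LP_of_prod (g : ℝ → ℝ) (w : ℕ → ℝ) (hw0 : ∀ j, 0 ≤ w j) (hws : Summable w)
    (hg : ∀ x, g x = ∏' j, (1 + x * w j)) : LaguerrePolya g := by
  have hw2 : Summable (fun k => w k ^ 2) := by
    refine Summable.of_nonneg_of_le (fun k => sq_nonneg _) (fun k => ?_) (hws.mul_right (∑' j, w j))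
    rw [sq]
    exact mul_le_mul_of_nonneg_left (hws.le_tsum k (fun j _ => hw0 j)) (hw0 k)
  refine ⟨1, 0, ∑' j, w j, 0, {j | w j ≠ 0}, fun j => -(w j)⁻¹, le_rfl, ?_, ?_, ?_⟩
  · intro k hk
    exact neg_ne_zero.mpr (inv_ne_zero hk)
  · have := hw2.comp_injective (i := ((↑) : {j | w j ≠ 0} → ℕ)) Subtype.val_injective
    refine this.congr (fun k => ?_)
    simp
  · intro t
    have e1 : ∀ k : {j | w j ≠ 0}, ((1 - t / (-(w (k : ℕ))⁻¹)) * Real.exp (t / (-(w (k : ℕ))⁻¹))) =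
        (fun j : ℕ => (1 + t * w j) * Real.exp (-(t * w j))) (k : ℕ) := by
      intro k
      have : t / (-(w (k : ℕ))⁻¹) = -(t * w k) := by rw [div_neg, div_inv_eq_mul]
      simp only [this]
      congr 1; ring
    have hsub : Function.mulSupport (fun j : ℕ => (1 + t * w j) * Real.exp (-(t * w j))) ⊆
        {j | w j ≠ 0} := by
      intro j hj h0
      apply hj
      simp [h0]
    rw [tprod_congr e1, tprod_subtype_eq_of_mulSupport_subset hsub]
    have hm1 : Multipliable (fun j => 1 + t * w j) := by
      refine multipliable_one_add_of_summable ?_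
      exact (hws.mul_left t).norm
    have hm2 : HasProd (fun j => Real.exp (-(t * w j))) (Real.exp (-(t * ∑' j, w j))) := by
      refine Real.hasProd_of_hasSum_log (fun j => Real.exp_pos _) ?_
      simp only [Real.log_exp]
      exact (hws.hasSum.mul_left t).neg
    rw [hm1.tprod_mul hm2.multipliable, hm2.tprod_eq, ← hg t]
    have : Real.exp (-0 * t ^ 2 + (∑' j, w j) * t) * Real.exp (-(t * ∑' j, w j)) = 1 := by
      rw [← Real.exp_add, ← Real.exp_zero]; congr 1; ring
    calc g t = (Real.exp (-0 * t ^ 2 + (∑' j, w j) * t) * Real.exp (-(t * ∑' j, w j))) * g t := by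
          rw [this, one_mul]
      _ = _ := by ring

lemma theta_LP {a τ : ℝ} (ha3 : 3 ≤ a ^ 2) (ha : 1 < a) (hτ0 : 0 < τ) (hτ3 : τ ≤ a ^ 3)
    (hg : ∑' k : ℕ, (-τ) ^ k / a ^ (k ^ 2) ≤ 0) :
    LaguerrePolya (fun x => ∑' j : ℕ, x ^ j / a ^ (j ^ 2)) := by
  have hb0 : 0 ≤ a⁻¹ := by positivity
  have hb1 : a⁻¹ < 1 := inv_lt_one_of_one_lt₀ ha
  have h : ∀ m : ℕ, ∃ w : ℕ → ℝ, (∀ j, 0 ≤ w j ∧ w j ≤ a⁻¹ ^ j) ∧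
      ∀ x, thetaPart a (2 * (m + 2) + 1) x = ∏' j, (1 + x * w j) := fun m =>
    thetaPart_real_rooted ha3 ha hτ0 hτ3 hg (2 * (m + 2) + 1) (odd_two_mul_add_one _) (by omega)
  choose W hW hWx using h
  have hcomp : IsCompact (Set.pi Set.univ (fun j : ℕ => Set.Icc (0:ℝ) (a⁻¹ ^ j))) :=
    isCompact_univ_pi (fun j => isCompact_Icc)
  obtain ⟨w, hwmem, φ, hφ, hlim⟩ := hcomp.tendsto_subseq (x := W)
    (fun m j _ => ⟨(hW m j).1, (hW m j).2⟩)
  have hwj : ∀ j, 0 ≤ w j ∧ w j ≤ a⁻¹ ^ j := fun j => hwmem j (Set.mem_univ j)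
  have hgeo : Summable (fun j : ℕ => a⁻¹ ^ j) := summable_geometric_of_lt_one hb0 hb1
  refine LP_of_prod _ w (fun j => (hwj j).1)
    (Summable.of_nonneg_of_le (fun j => (hwj j).1) (fun j => (hwj j).2) hgeo) ?_
  intro x
  rw [tendsto_pi_nhds] at hlim
  have h1 : Tendsto (fun m => ∏' j, (1 + x * W (φ m) j)) atTop (nhds (∏' j, (1 + x * w j))) := by
    refine tendsto_tprod_one_add_of_dominated_convergence
      (f := fun m j => x * W (φ m) j) (g := fun j => x * w j)
      (bound := fun j => |x| * a⁻¹ ^ j) (hgeo.mul_left _) ?_ ?_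
    · intro j
      exact (hlim j).const_mul x
    · refine Eventually.of_forall (fun m j => ?_)
      rw [Real.norm_eq_abs, abs_mul, abs_of_nonneg (hW (φ m) j).1]
      exact mul_le_mul_of_nonneg_left (hW (φ m) j).2 (abs_nonneg x)
  have h2 : Tendsto (fun m => thetaPart a (2 * (φ m + 2) + 1) x) atTop
      (nhds (∑' j : ℕ, x ^ j / a ^ (j ^ 2))) := by
    have hbase := (theta_summable ha x).hasSum.tendsto_sum_nat
    have hsub : Tendsto (fun m => 2 * (φ m + 2) + 1 + 1) atTop atTop := by
      refine tendsto_atTop_mono (fun m => ?_) hφ.tendsto_atTop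
      omega
    exact hbase.comp hsub
  have h3 : (fun m => thetaPart a (2 * (φ m + 2) + 1) x) =
      fun m => ∏' j, (1 + x * W (φ m) j) := by
    funext m; exact hWx (φ m) x
  rw [h3] at h2
  exact tendsto_nhds_unique h2 h1

/-- if `f(z) = ∑ aₖ zᵏ` is entire with positive coefficients, the second
quotients `qₙ(f) = a_{n-1}²/(a_{n-2}aₙ)` are increasing in `n`, and `qₙ(f) → c < q_∞`,
then `f` does not belong to the Laguerre–Pólya class. -/
theorem statement0 (a : ℕ → ℝ) (hpos : ∀ k, 0 < a k)
    (hent : ∀ z : ℂ, Summable fun k : ℕ => (a k : ℂ) * z ^ k)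
    (c : ℝ)
    (hmono : ∀ n : ℕ, 2 ≤ n →
      a (n - 1) ^ 2 / (a (n - 2) * a n) ≤ a n ^ 2 / (a (n - 1) * a (n + 1)))
    (hlim : Tendsto (fun n : ℕ => a (n - 1) ^ 2 / (a (n - 2) * a n)) atTop (nhds c))
    (hc : c < qInfty) :
    ¬ LaguerrePolya (fun x : ℝ => ∑' k : ℕ, a k * x ^ k) := by
  intro hLP
  have hs := real_summable hent
  set Q : ℕ → ℝ := fun k => a (k + 1) ^ 2 / (a k * a (k + 2)) with hQdef
  have hQm : Monotone Q := by
    refine monotone_nat_of_le_succ (fun k => ?_)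
    have := hmono (k + 2) (by omega)
    simpa [hQdef, add_assoc] using this
  have hQlim : Tendsto Q atTop (nhds c) := by
    have := (tendsto_add_atTop_iff_nat 2).mpr hlim
    simpa [hQdef] using this
  have hQc : ∀ k, Q k ≤ c := fun k => hQm.ge_of_tendsto hQlim k
  have hq := hmono 2 le_rfl
  norm_num at hq
  obtain ⟨h3, t0, ht0, ht1, hz⟩ := LP_zero a hpos hs hq hLP
  have hQ3 : 3 ≤ Q 0 := by simpa [hQdef] using h3
  have hc3 : 3 ≤ c := hQ3.trans (hQc 0)
  set α := Real.sqrt c with hα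
  have hα2 : α ^ 2 = c := Real.sq_sqrt (by linarith)
  have hα0 : 0 ≤ α := Real.sqrt_nonneg c
  have hα1 : 1 < α := by
    by_contra h
    push Not at h
    nlinarith
  have hαne : α ≠ 0 := by linarith
  have p0 := hpos 0
  have p1 := hpos 1
  have p2 := hpos 2
  set t : ℝ := t0 * a 1 / a 0 with htdef
  have ht : 0 < t := by positivity
  have htQ : t ≤ Q 0 := by
    have : t ≤ (a 1 / a 2) * a 1 / a 0 := by rw [htdef]; gcongr
    refine this.trans (le_of_eq ?_)
    simp only [hQdef]
    field_simp
  have hbt : ∀ (s : ℝ) (k : ℕ), a k / a 0 * (a 0 / a 1) ^ k * (s * a 1 / a 0) ^ k =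
      (a 0)⁻¹ * (a k * s ^ k) := by
    intro s k
    rw [mul_assoc, ← mul_pow]
    have : a 0 / a 1 * (s * a 1 / a 0) = s := by field_simp
    rw [this]; ring
  have hnegt : -t = (-t0) * a 1 / a 0 := by rw [htdef]; ring
  have hcmp := compare_theta (fun k => a k / a 0 * (a 0 / a 1) ^ k)
    (fun k => α ^ (k ^ 2) / α ^ k) Q c t
    (fun k => by have := hpos k; positivity) (fun k => by positivity)
    (by simp [p0.ne']) (by field_simp) (by simp)
    (fun k => by
      have e : α ^ ((k + 1) ^ 2) = α ^ (k ^ 2) * (α ^ 2) ^ k * α := by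
        rw [← pow_mul, ← pow_add, ← pow_succ]; congr 1; ring
      rw [← hα2, e, pow_succ α k]
      field_simp)
    (fun k => by
      have h0 := (hpos k).ne'
      have h2 := (hpos (k + 2)).ne'
      have e1 : (a 0 / a 1) ^ (k + 2) * (a 0 / a 1) ^ k = ((a 0 / a 1) ^ (k + 1)) ^ 2 := by ring
      have e2 : Q k * (a k * a (k + 2)) = a (k + 1) ^ 2 := by
        simp only [hQdef]; field_simp
      calc _ = (Q k * (a k * a (k + 2))) * ((a 0 / a 1) ^ (k + 2) * (a 0 / a 1) ^ k) / a 0 ^ 2 := by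
            ring
        _ = _ := by rw [e1, e2]; ring)
    hQm hQ3 hQc ht htQ
    (by
      have := (hs t0).mul_left (a 0)⁻¹
      refine this.congr (fun k => ?_)
      rw [htdef, hbt])
  have hzero : ∑' k : ℕ, a k / a 0 * (a 0 / a 1) ^ k * (-t) ^ k = 0 := by
    rw [hnegt]
    simp only [hbt]
    rw [tsum_mul_left, hz, mul_zero]
  rw [hzero] at hcmp
  have hg : ∑' k : ℕ, (-(t * α)) ^ k / α ^ (k ^ 2) ≤ 0 := by
    refine le_trans (le_of_eq (tsum_congr (fun k => ?_))) hcmp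
    rw [← neg_mul, mul_pow]
    field_simp
  have hτ3 : t * α ≤ α ^ 3 := by
    have h1 : t ≤ α ^ 2 := by rw [hα2]; exact htQ.trans (hQc 0)
    calc t * α ≤ α ^ 2 * α := mul_le_mul_of_nonneg_right h1 hα0
      _ = α ^ 3 := by ring
  have hfin := theta_LP (by rw [hα2]; exact hc3) hα1 (by positivity) hτ3 hg
  have hle : qInfty ≤ c := by
    refine csInf_le ⟨0, ?_⟩ ⟨α, hα1, hα2.symm, hfin⟩
    rintro s ⟨b, _, rfl, _⟩
    exact sq_nonneg b
  linarith
end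

section
/- Let φ(z) = Σ_{k=0}^∞ (-1)^k a_k z^k be an entire function with a_k > 0 for all k, a_0 = a_1 = 1, and suppose the quotients q_n(φ) := a_{n-1}²/(a_{n-2} a_n) are increasing in n (q_2 ≤ q_3 ≤ q_4 ≤ ...). If φ belongs to the Laguerre–Pólya class, then q_2 ≥ 3. -/
open Filter Finset

section Helpers
open Filter Finset Topology Asymptotics

lemma lp_factor_bound {y : ℝ} (hy : |y| ≤ 1) : |(1 - y) * Real.exp y - 1| ≤ 3 * y ^ 2 := by
  have h := Real.abs_exp_sub_one_sub_id_le hy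
  have e : (1 - y) * Real.exp y - 1 = (1 - y) * (Real.exp y - 1 - y) - y ^ 2 := by ring
  rw [e]
  have h1 : |1 - y| ≤ 2 := by
    rw [abs_le] at hy ⊢; constructor <;> linarith [hy.1, hy.2]
  calc |(1 - y) * (Real.exp y - 1 - y) - y ^ 2|
      ≤ |(1 - y) * (Real.exp y - 1 - y)| + |y ^ 2| := abs_sub _ _
    _ ≤ 2 * y ^ 2 + y ^ 2 := by
        rw [abs_mul, abs_of_nonneg (sq_nonneg y)]
        gcongr
    _ = 3 * y ^ 2 := by ring

lemma lp_tendsto {ι : Type*} {u : ι → ℝ} (hs : Summable fun k => u k ^ 2) :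
    Tendsto u cofinite (𝓝 0) := by
  have h := hs.tendsto_cofinite_zero
  have h2 := (Real.continuous_sqrt.tendsto 0).comp h
  rw [Real.sqrt_zero] at h2
  have h3 : Tendsto (fun k => |u k|) cofinite (𝓝 0) := by
    refine h2.congr fun k => ?_
    simp [Real.sqrt_sq_eq_abs]
  exact (tendsto_zero_iff_abs_tendsto_zero _).2 h3

lemma lp_multipliable {ι : Type*} {u : ι → ℝ} (hs : Summable fun k => u k ^ 2) (t : ℝ) :
    Multipliable fun k => (1 - t * u k) * Real.exp (t * u k) := by
  have h : Summable fun k => ‖(1 - t * u k) * Real.exp (t * u k) - 1‖ := by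
    refine summable_of_isBigO (hs.mul_left (t ^ 2)) ?_
    refine IsBigO.of_bound 3 ?_
    have h0 : Tendsto (fun k => |t * u k|) cofinite (𝓝 0) := by
      have := ((lp_tendsto hs).const_mul t).abs
      simpa using this
    filter_upwards [h0.eventually (ge_mem_nhds zero_lt_one)] with k hk
    have := lp_factor_bound hk
    rw [norm_norm, Real.norm_eq_abs, Real.norm_of_nonneg (show 0 ≤ t ^ 2 * u k ^ 2 by positivity)]
    rw [mul_pow] at this
    exact this
  have := multipliable_one_add_of_summable h
  refine this.congr fun k => ?_
  ring

lemma lp_tprod_zero {ι : Type*} {f : ι → ℝ} (hf : Multipliable f) (k : ι) (hk : f k = 0) :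
    ∏' i, f i = 0 := by
  have h : HasProd f 0 := by
    refine tendsto_const_nhds.congr' ?_
    filter_upwards [eventually_ge_atTop ({k} : Finset ι)] with s hs
    exact (Finset.prod_eq_zero (hs (Finset.mem_singleton_self k)) hk).symm
  exact h.tprod_eq

lemma lp_tprod_le {ι : Type*} {f : ι → ℝ} (hf : Multipliable f) (h0 : ∀ i, 0 ≤ f i)
    (h1 : ∀ i, f i ≤ 1) (F : Finset ι) : ∏' i, f i ≤ ∏ i ∈ F, f i := by
  classical
  refine le_of_tendsto hf.hasProd ?_
  filter_upwards [eventually_ge_atTop F] with G hG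
  rw [← Finset.prod_sdiff hG]
  exact mul_le_of_le_one_left (Finset.prod_nonneg fun i _ => h0 i)
    (Finset.prod_le_one (fun i _ => h0 i) fun i _ => h1 i)

lemma lp_const_zero {c C δ : ℝ} (hδ : 0 < δ) (h : ∀ t, 0 < t → t < δ → |c| ≤ C * t) : c = 0 := by
  by_contra hc
  have hc' : 0 < |c| := abs_pos.2 hc
  have ht : 0 < min (δ / 2) (|c| / (2 * (|C| + 1))) := by positivity
  have := h _ ht (lt_of_le_of_lt (min_le_left _ _) (by linarith))
  have h2 : C * min (δ / 2) (|c| / (2 * (|C| + 1))) ≤ |c| / 2 := by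
    calc C * min (δ / 2) (|c| / (2 * (|C| + 1)))
        ≤ (|C| + 1) * (|c| / (2 * (|C| + 1))) := by
          apply mul_le_mul _ (min_le_right _ _) ht.le (by positivity)
          linarith [le_abs_self C]
      _ = |c| / 2 := by field_simp
  linarith

lemma lp_coeff_zero {c1 c2 c3 : ℝ}
    (h : (fun t : ℝ => c1 * t + c2 * t ^ 2 + c3 * t ^ 3) =O[𝓝 0] fun t : ℝ => t ^ 4) :
    c1 = 0 ∧ c2 = 0 ∧ c3 = 0 := by
  obtain ⟨C, hC⟩ := h.bound
  obtain ⟨δ, hδ, hb⟩ := Metric.eventually_nhds_iff.1 hC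
  have hb' : ∀ t, 0 < t → t < min δ 1 → |c1 * t + c2 * t ^ 2 + c3 * t ^ 3| ≤ |C| * t ^ 4 := by
    intro t h0 h1
    have := @hb t (by rw [Real.dist_eq, sub_zero, abs_of_pos h0]; exact lt_of_lt_of_le h1 (min_le_left _ _))
    rw [Real.norm_eq_abs, Real.norm_eq_abs, abs_of_pos (a := t ^ 4) (by positivity)] at this
    exact this.trans (by gcongr; exact le_abs_self C)
  have hd : 0 < min δ 1 := by positivity
  have e1 : c1 = 0 := by
    refine lp_const_zero (C := |C| + |c2| + |c3|) hd fun t h0 h1 => ?_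
    have ht1 : t ≤ 1 := h1.le.trans (min_le_right _ _)
    have := hb' t h0 h1
    have e : c1 * t = (c1 * t + c2 * t ^ 2 + c3 * t ^ 3) - c2 * t ^ 2 - c3 * t ^ 3 := by ring
    have h3 : |c1| * t ≤ |C| * t ^ 4 + |c2| * t ^ 2 + |c3| * t ^ 3 := by
      calc |c1| * t = |c1 * t| := by rw [abs_mul, abs_of_pos h0]
        _ ≤ |c1 * t + c2 * t ^ 2 + c3 * t ^ 3| + |c2 * t ^ 2| + |c3 * t ^ 3| := by
          rw [e]; refine (abs_sub _ _).trans ?_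
          gcongr
          refine (abs_sub _ _).trans ?_
          rw [← e]
        _ ≤ _ := by
          rw [abs_mul c2, abs_mul c3, abs_of_pos (pow_pos h0 2), abs_of_pos (pow_pos h0 3)]
          gcongr
    have t4 : t ^ 4 ≤ t ^ 2 := pow_le_pow_of_le_one h0.le ht1 (by norm_num)
    have t3 : t ^ 3 ≤ t ^ 2 := pow_le_pow_of_le_one h0.le ht1 (by norm_num)
    have h4 : |c1| * t ≤ ((|C| + |c2| + |c3|) * t) * t := by
      have := mul_le_mul_of_nonneg_left t4 (abs_nonneg C)
      have := mul_le_mul_of_nonneg_left t3 (abs_nonneg c3)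
      nlinarith
    exact le_of_mul_le_mul_right h4 h0
  subst e1
  have e2 : c2 = 0 := by
    refine lp_const_zero (C := |C| + |c3|) hd fun t h0 h1 => ?_
    have ht1 : t ≤ 1 := h1.le.trans (min_le_right _ _)
    have := hb' t h0 h1
    have e : c2 * t ^ 2 = (0 * t + c2 * t ^ 2 + c3 * t ^ 3) - c3 * t ^ 3 := by ring
    have h3 : |c2| * t ^ 2 ≤ |C| * t ^ 4 + |c3| * t ^ 3 := by
      calc |c2| * t ^ 2 = |c2 * t ^ 2| := by rw [abs_mul, abs_of_pos (pow_pos h0 2)]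
        _ ≤ |0 * t + c2 * t ^ 2 + c3 * t ^ 3| + |c3 * t ^ 3| := by
          rw [e]; refine (abs_sub _ _).trans ?_
          rw [← e]
        _ ≤ _ := by
          rw [abs_mul c3, abs_of_pos (pow_pos h0 3)]
          gcongr
    have t4 : t ^ 4 ≤ t ^ 3 := pow_le_pow_of_le_one h0.le ht1 (by norm_num)
    have h4 : |c2| * t ^ 2 ≤ ((|C| + |c3|) * t) * t ^ 2 := by
      have := mul_le_mul_of_nonneg_left t4 (abs_nonneg C)
      nlinarith
    exact le_of_mul_le_mul_right h4 (by positivity)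
  subst e2
  refine ⟨rfl, rfl, lp_const_zero (C := |C|) hd fun t h0 h1 => ?_⟩
  have := hb' t h0 h1
  have h4 : |c3| * t ^ 3 ≤ (|C| * t) * t ^ 3 := by
    calc |c3| * t ^ 3 = |0 * t + 0 * t ^ 2 + c3 * t ^ 3| := by
          rw [show 0 * t + 0 * t ^ 2 + c3 * t ^ 3 = c3 * t ^ 3 by ring, abs_mul,
            abs_of_pos (pow_pos h0 3)]
      _ ≤ |C| * t ^ 4 := this
      _ = _ := by ring
  exact le_of_mul_le_mul_right h4 (by positivity)

/-- exponential of a cubic up to fourth order -/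
lemma lp_exp_expand {L : ℝ → ℝ} {β A B : ℝ}
    (hL : (fun t => L t - (β * t + A * t ^ 2 + B * t ^ 3)) =O[𝓝 0] fun t : ℝ => t ^ 4) :
    (fun t => Real.exp (L t) - (1 + β * t + (A + β ^ 2 / 2) * t ^ 2
      + (B + β * A + β ^ 3 / 6) * t ^ 3)) =O[𝓝 0] fun t : ℝ => t ^ 4 := by
  have pw : ∀ m n : ℕ, n ≤ m → (fun t : ℝ => t ^ m) =O[𝓝 0] fun t : ℝ => t ^ n := by
    intro m n h
    refine IsBigO.of_bound 1 ?_
    filter_upwards [Metric.closedBall_mem_nhds (0 : ℝ) one_pos] with t ht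
    rw [Metric.mem_closedBall, dist_zero_right] at ht
    rw [norm_pow, norm_pow, one_mul]
    exact pow_le_pow_of_le_one (norm_nonneg _) ht h
  have hQ : (fun t : ℝ => β * t + A * t ^ 2 + B * t ^ 3) =O[𝓝 0] fun t : ℝ => t ^ 1 := by
    refine IsBigO.add (IsBigO.add ?_ ?_) ?_
    · simpa using (pw 1 1 le_rfl).const_mul_left β
    · exact (pw 2 1 (by norm_num)).const_mul_left A
    · exact (pw 3 1 (by norm_num)).const_mul_left B
  have hL1 : L =O[𝓝 0] fun t : ℝ => t ^ 1 := by
    have := (hL.trans (pw 4 1 (by norm_num))).add hQ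
    simpa using this
  have hLt : Tendsto L (𝓝 0) (𝓝 0) := by
    refine hL1.trans_tendsto ?_
    simpa using (continuous_pow 1).tendsto (0 : ℝ)
  have hexp : (fun t => Real.exp (L t) - (1 + L t + L t ^ 2 / 2 + L t ^ 3 / 6)) =O[𝓝 0]
      fun t : ℝ => t ^ 4 := by
    have h4 : (fun t => L t ^ 4) =O[𝓝 0] fun t : ℝ => t ^ 4 := by
      simpa using hL1.pow 4
    refine IsBigO.trans ?_ h4
    refine IsBigO.of_bound 1 ?_
    filter_upwards [hLt.eventually (Metric.closedBall_mem_nhds (0 : ℝ) one_pos)] with t ht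
    rw [dist_zero_right] at ht
    have := Real.exp_bound (x := L t) ht (n := 4) (by norm_num)
    simp only [Finset.sum_range_succ, Finset.sum_range_zero, Nat.factorial] at this
    norm_num at this
    rw [Real.norm_eq_abs, norm_pow, Real.norm_eq_abs, one_mul]
    refine this.trans ?_
    rw [← abs_pow, abs_of_nonneg (show 0 ≤ L t ^ 4 by positivity)]
    nlinarith [show 0 ≤ L t ^ 4 by positivity]
  have sm : ∀ {f g : ℝ → ℝ}, f =O[𝓝 0] (fun t : ℝ => t ^ 4) → g =O[𝓝 0] (fun t : ℝ => t ^ 1) →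
      (fun t => f t * g t) =O[𝓝 0] fun t : ℝ => t ^ 4 := by
    intro f g hf hg
    have := hf.mul (hg.trans (pw 1 0 (by norm_num)))
    simpa using this
  have b2 : (fun t => L t ^ 2 - (β * t + A * t ^ 2 + B * t ^ 3) ^ 2) =O[𝓝 0]
      fun t : ℝ => t ^ 4 := by
    refine (sm hL (hL1.add hQ)).congr_left fun t => by ring
  have b3 : (fun t => L t ^ 3 - (β * t + A * t ^ 2 + B * t ^ 3) ^ 3) =O[𝓝 0]
      fun t : ℝ => t ^ 4 := by
    refine ((sm b2 hL1).add (sm (sm hL hQ) hQ)).congr_left fun t => by ring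
  have mono : ∀ (c : ℝ) (m : ℕ), 4 ≤ m → (fun t : ℝ => c * t ^ m) =O[𝓝 0] fun t : ℝ => t ^ 4 :=
    fun c m h => (pw m 4 h).const_mul_left c
  have total := hexp.add (hL.add ((b2.const_mul_left (1 / 2)).add (b3.const_mul_left (1 / 6))))
  have rest : (fun t : ℝ => (β * t + A * t ^ 2 + B * t ^ 3) ^ 2 / 2
      + (β * t + A * t ^ 2 + B * t ^ 3) ^ 3 / 6
      - (β ^ 2 / 2 * t ^ 2 + β * A * t ^ 3 + β ^ 3 / 6 * t ^ 3)) =O[𝓝 0] fun t : ℝ => t ^ 4 := by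
    have := ((((((mono (A ^ 2 / 2 + β * B + β ^ 2 * A / 2) 4 le_rfl).add
      (mono (A * B + (β * A ^ 2 + β ^ 2 * B) / 2) 5 (by norm_num))).add
      (mono (B ^ 2 / 2 + A ^ 3 / 6 + β * A * B) 6 (by norm_num))).add
      (mono ((A ^ 2 * B + β * B ^ 2) / 2) 7 (by norm_num))).add
      (mono (A * B ^ 2 / 2) 8 (by norm_num))).add (mono (B ^ 3 / 6) 9 (by norm_num)))
    refine this.congr_left fun t => by ring
  exact (total.add rest).congr_left fun t => by ring

/-- the canonical product as an exponential, up to fourth order -/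
lemma lp_prod_expand {ι : Type*} {u : ι → ℝ} (hs : Summable fun k => u k ^ 2)
    (hs3 : Summable fun k => u k ^ 3) (hs4 : Summable fun k => u k ^ 4)
    (hb : ∃ M, ∀ k, |u k| ≤ M) :
    ∃ l : ℝ → ℝ, (∀ᶠ t in 𝓝 (0 : ℝ),
      ∏' k, ((1 - t * u k) * Real.exp (t * u k)) = Real.exp (l t)) ∧
      (fun t => l t + (∑' k, u k ^ 2) / 2 * t ^ 2 + (∑' k, u k ^ 3) / 3 * t ^ 3)
        =O[𝓝 0] fun t : ℝ => t ^ 4 := by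
  obtain ⟨M, hM⟩ := hb
  refine ⟨fun t => ∑' k, (Real.log (1 - t * u k) + t * u k), ?_, ?_⟩ <;> skip
  all_goals
    have key : ∀ᶠ t in 𝓝 (0 : ℝ), ∀ k, |t * u k| ≤ 1 / 2 := by
      have : Tendsto (fun t : ℝ => |t| * |M|) (𝓝 0) (𝓝 0) := by
        have : Continuous fun t : ℝ => |t| * |M| := by fun_prop
        simpa using this.tendsto 0
      filter_upwards [this.eventually (ge_mem_nhds (show (0 : ℝ) < 1 / 2 by norm_num))] with t ht k
      rw [abs_mul]
      exact (mul_le_mul_of_nonneg_left ((hM k).trans (le_abs_self M)) (abs_nonneg t)).trans ht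
    have bound : ∀ t : ℝ, (∀ k, |t * u k| ≤ 1 / 2) → ∀ k,
        |Real.log (1 - t * u k) + t * u k + u k ^ 2 * (t ^ 2 / 2) + u k ^ 3 * (t ^ 3 / 3)|
          ≤ u k ^ 4 * (2 * t ^ 4) := by
      intro t ht k
      have h := Real.abs_log_sub_add_sum_range_le (x := t * u k) (by linarith [ht k]) 3
      simp only [Finset.sum_range_succ, Finset.sum_range_zero] at h
      norm_num at h
      have e : Real.log (1 - t * u k) + t * u k + u k ^ 2 * (t ^ 2 / 2) + u k ^ 3 * (t ^ 3 / 3)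
        = t * u k + (t * u k) ^ 2 / 2 + (t * u k) ^ 3 / 3 + Real.log (1 - t * u k) := by ring
      rw [e]
      refine h.trans ?_
      rw [← abs_mul, ← abs_pow, abs_of_nonneg (show 0 ≤ (t * u k) ^ 4 by positivity)]
      rw [div_le_iff₀ (by linarith [ht k])]
      have : 0 ≤ (t * u k) ^ 4 := by positivity
      have := mul_nonneg this (show 0 ≤ 1 - 2 * |t * u k| + 0 by linarith [ht k])
      nlinarith [ht k]
    have sumR : ∀ t : ℝ, (∀ k, |t * u k| ≤ 1 / 2) → Summable fun k =>
        (Real.log (1 - t * u k) + t * u k + u k ^ 2 * (t ^ 2 / 2) + u k ^ 3 * (t ^ 3 / 3)) :=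
      fun t ht => Summable.of_norm_bounded (hs4.mul_right _) (bound t ht)
    have sumL : ∀ t : ℝ, (∀ k, |t * u k| ≤ 1 / 2) → Summable fun k =>
        (Real.log (1 - t * u k) + t * u k) := by
      intro t ht
      refine (((sumR t ht).sub (hs.mul_right (t ^ 2 / 2))).sub
        (hs3.mul_right (t ^ 3 / 3))).congr fun k => ?_
      ring
  · filter_upwards [key] with t ht
    have hp := (sumL t ht).hasSum.rexp
    rw [← hp.tprod_eq]
    refine tprod_congr fun k => ?_
    have : 0 < 1 - t * u k := by linarith [(abs_le.1 (ht k)).2]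
    simp [Real.exp_add, Real.exp_log this]
  · refine IsBigO.of_bound (2 * ∑' k, u k ^ 4) ?_
    filter_upwards [key] with t ht
    have e : ∑' k, (Real.log (1 - t * u k) + t * u k) + (∑' k, u k ^ 2) / 2 * t ^ 2
        + (∑' k, u k ^ 3) / 3 * t ^ 3 = ∑' k, (Real.log (1 - t * u k) + t * u k
          + u k ^ 2 * (t ^ 2 / 2) + u k ^ 3 * (t ^ 3 / 3)) := by
      rw [(((sumL t ht).add (hs.mul_right (t ^ 2 / 2)))).tsum_add (hs3.mul_right (t ^ 3 / 3)),
        (sumL t ht).tsum_add (hs.mul_right (t ^ 2 / 2)), tsum_mul_right, tsum_mul_right]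
      ring
    simp only [e]
    have := tsum_of_norm_bounded (f := fun k => Real.log (1 - t * u k) + t * u k
      + u k ^ 2 * (t ^ 2 / 2) + u k ^ 3 * (t ^ 3 / 3)) ((hs4.mul_right (2 * t ^ 4)).hasSum)
      (bound t ht)
    refine this.trans (le_of_eq ?_)
    rw [tsum_mul_right, Real.norm_of_nonneg (by positivity)]
    ring

lemma lp_series_expand {a : ℕ → ℝ} (hpos : ∀ k, 0 < a k) (ha : Summable a) (ha0 : a 0 = 1)
    (ha1 : a 1 = 1) :
    (fun t : ℝ => ∑' k : ℕ, (-1 : ℝ) ^ k * a k * t ^ k - (1 - t + a 2 * t ^ 2 - a 3 * t ^ 3))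
      =O[𝓝 0] fun t : ℝ => t ^ 4 := by
  refine IsBigO.of_bound (∑' k, a (k + 4)) ?_
  filter_upwards [Metric.closedBall_mem_nhds (0 : ℝ) one_pos] with t ht
  rw [Metric.mem_closedBall, dist_zero_right] at ht
  have hb : ∀ k, ‖(-1 : ℝ) ^ k * a k * t ^ k‖ ≤ a k := by
    intro k
    rw [norm_mul, norm_mul, norm_pow, norm_pow, norm_neg, norm_one, one_pow, one_mul,
      Real.norm_of_nonneg (hpos k).le]
    exact mul_le_of_le_one_right (hpos k).le (pow_le_one₀ (norm_nonneg _) ht)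
  have hsum := Summable.of_norm_bounded ha hb
  have h4 := hsum.sum_add_tsum_nat_add 4
  simp only [Finset.sum_range_succ, Finset.sum_range_zero] at h4
  rw [← h4, ha0, ha1]
  have hs4 := (summable_nat_add_iff 4).2 ha
  have := tsum_of_norm_bounded (f := fun k : ℕ => (-1 : ℝ) ^ (k + 4) * a (k + 4) * t ^ (k + 4))
    ((hs4.mul_right (‖t ^ 4‖)).hasSum) (fun k => by
      rw [norm_mul, norm_mul, norm_pow, norm_neg, norm_one, one_pow, one_mul,
        Real.norm_of_nonneg (hpos _).le, pow_add, norm_mul]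
      have : ‖t ^ k‖ ≤ 1 := by rw [norm_pow]; exact pow_le_one₀ (norm_nonneg _) ht
      have h2 := (hpos (k + 4)).le
      gcongr
      exact mul_le_of_le_one_left (norm_nonneg _) this)
  rw [tsum_mul_right] at this
  refine le_trans (le_of_eq ?_) this
  congr 1
  ring

lemma lp_sum_le_one {ι : Type*} {u : ι → ℝ} (hu : ∀ k, 0 < u k) (F : Finset ι)
    (h : ∀ s : ℝ, 0 < s → 1 ≤ Real.exp s * ∏ k ∈ F, ((1 + s * u k) * Real.exp (-(s * u k)))) :
    ∑ k ∈ F, u k ≤ 1 := by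
  by_contra! hσ
  set σ := ∑ k ∈ F, u k with hσd
  set ε := (σ - 1) / (2 * σ) with hε
  have hε0 : 0 < ε := div_pos (by linarith) (by linarith)
  have hε1 : ε ≤ 1 := by rw [hε, div_le_one (by linarith)]; linarith
  have hεσ : ε * σ = (σ - 1) / 2 := by
    have : σ ≠ 0 := by linarith
    rw [hε]; field_simp
  set d := (σ - 1) / 2 with hd
  have hd0 : 0 < d := by rw [hd]; linarith
  set K := (ε⁻¹) ^ F.card with hK
  have hK0 : 0 < K := by positivity
  have main : ∀ s : ℝ, 0 < s → Real.exp (s * d) ≤ K := by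
    intro s hs
    have h1 := h s hs
    have h2 : ∏ k ∈ F, ((1 + s * u k) * Real.exp (-(s * u k)))
        ≤ ∏ k ∈ F, (ε⁻¹ * Real.exp ((ε - 1) * s * u k)) := by
      refine Finset.prod_le_prod (fun k _ => ?_) fun k _ => ?_
      · have := hu k; positivity
      · have h3 := Real.add_one_le_exp (ε * (s * u k))
        have h4 : 0 < s * u k := mul_pos hs (hu k)
        have h5 : 1 + s * u k ≤ ε⁻¹ * Real.exp (ε * (s * u k)) := by
          rw [inv_mul_eq_div, le_div_iff₀ hε0]
          nlinarith
        calc (1 + s * u k) * Real.exp (-(s * u k))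
            ≤ ε⁻¹ * Real.exp (ε * (s * u k)) * Real.exp (-(s * u k)) := by gcongr
          _ = ε⁻¹ * Real.exp ((ε - 1) * s * u k) := by
            rw [mul_assoc, ← Real.exp_add]; congr 2; ring
    have e2 : ∏ k ∈ F, (ε⁻¹ * Real.exp ((ε - 1) * s * u k))
        = K * Real.exp ((ε - 1) * s * σ) := by
      rw [Finset.prod_mul_distrib, Finset.prod_const, ← Real.exp_sum, ← Finset.mul_sum]
    rw [e2] at h2
    have h6 : 1 ≤ K * Real.exp (-(s * d)) := by
      calc 1 ≤ Real.exp s * (K * Real.exp ((ε - 1) * s * σ)) :=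
            h1.trans (mul_le_mul_of_nonneg_left h2 (Real.exp_pos _).le)
        _ = K * (Real.exp s * Real.exp ((ε - 1) * s * σ)) := by ring
        _ = K * Real.exp (-(s * d)) := by
          rw [← Real.exp_add]; congr 2
          have : (ε - 1) * s * σ = s * (ε * σ) - s * σ := by ring
          rw [this, hεσ, hd]; ring
    rw [Real.exp_neg, ← div_eq_mul_inv, le_div_iff₀ (Real.exp_pos _), one_mul] at h6
    exact h6
  have h7 := main (K / d) (by positivity)
  rw [div_mul_cancel₀ _ hd0.ne'] at h7
  linarith [Real.add_one_le_exp K]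

end Helpers

/-- if `φ(z) = ∑ (-1)ᵏ aₖ zᵏ` is entire with `aₖ > 0`, `a₀ = a₁ = 1`,
the second quotients `qₙ = a_{n-1}²/(a_{n-2}aₙ)` are increasing in `n`, and
`φ ∈ L-P`, then `q₂ ≥ 3`. -/
theorem statement1 (a : ℕ → ℝ) (hpos : ∀ k, 0 < a k) (ha0 : a 0 = 1) (ha1 : a 1 = 1)
    (hent : ∀ z : ℂ, Summable fun k : ℕ => (-1 : ℂ) ^ k * (a k : ℂ) * z ^ k)
    (hmono : ∀ n : ℕ, 2 ≤ n →
      a (n - 1) ^ 2 / (a (n - 2) * a n) ≤ a n ^ 2 / (a (n - 1) * a (n + 1)))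
    (hLP : LaguerrePolya (fun x : ℝ => ∑' k : ℕ, (-1 : ℝ) ^ k * a k * x ^ k)) :
    3 ≤ a 1 ^ 2 / (a 0 * a 2) := by
  classical
  obtain ⟨c, α, β, n, I, x, hα, hx, hs, hf⟩ := hLP
  set u : I → ℝ := fun k => (x k)⁻¹ with hu
  replace hs : Summable fun k : I => u k ^ 2 := hs
  have hf' : ∀ t : ℝ, ∑' k : ℕ, (-1 : ℝ) ^ k * a k * t ^ k = c * t ^ n *
      Real.exp (-α * t ^ 2 + β * t) * ∏' k : I, ((1 - t * u k) * Real.exp (t * u k)) := by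
    intro t
    simpa only [div_eq_mul_inv] using hf t
  clear hf
  -- summability of the positive series
  have hsumpos : ∀ s : ℝ, 0 ≤ s → Summable fun k => a k * s ^ k := by
    intro s hs0
    have := (hent (s : ℂ)).norm
    refine this.congr fun k => ?_
    simp [abs_of_pos (hpos k), abs_of_nonneg hs0]
  have ha : Summable a := by simpa using hsumpos 1 zero_le_one
  have hneg : ∀ s : ℝ, 0 ≤ s → 1 ≤ ∑' k : ℕ, (-1 : ℝ) ^ k * a k * (-s) ^ k := by
    intro s hs0
    have e : ∀ k : ℕ, (-1 : ℝ) ^ k * a k * (-s) ^ k = a k * s ^ k := by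
      intro k
      rw [neg_pow s k, show (-1 : ℝ) ^ k * a k * ((-1) ^ k * s ^ k)
        = ((-1 : ℝ) ^ k * (-1) ^ k) * (a k * s ^ k) by ring, ← mul_pow]
      norm_num
    simp only [e]
    have := (hsumpos s hs0).le_tsum 0 (fun k _ => mul_nonneg (hpos k).le (pow_nonneg hs0 k))
    simpa [ha0] using this
  have hzero : ∑' k : ℕ, (-1 : ℝ) ^ k * a k * (0 : ℝ) ^ k = 1 := by
    rw [tsum_eq_single 0 (fun k hk => by simp [hk])]
    simp [ha0]
  have h0 := hf' 0
  rw [hzero] at h0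
  simp only [zero_mul, sub_zero, Real.exp_zero, mul_one, tprod_one, mul_zero, ne_eq,
    OfNat.ofNat_ne_zero, not_false_eq_true, zero_pow, add_zero] at h0
  have hn : n = 0 := by
    by_contra hn
    rw [zero_pow hn, mul_zero] at h0
    exact one_ne_zero h0
  subst hn
  have hc : c = 1 := by simpa using h0.symm
  subst hc
  simp only [pow_zero, one_mul, mul_one] at hf'
  have hupos : ∀ k, 0 < u k := by
    intro k
    have hne : u k ≠ 0 := inv_ne_zero (hx k k.2)
    by_contra hlt
    have hlt' : u k < 0 := lt_of_le_of_ne (not_lt.1 hlt) hne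
    have h1 := hneg (-(u k)⁻¹) (by rw [neg_nonneg]; exact (inv_neg''.2 hlt').le)
    rw [hf', lp_tprod_zero (lp_multipliable hs _) k (by
      rw [neg_neg, inv_mul_cancel₀ hne]; simp), mul_zero] at h1
    linarith
  -- boundedness and higher power sums
  set M := 1 + ∑' k, u k ^ 2 with hMd
  have hS : 0 ≤ ∑' k, u k ^ 2 := tsum_nonneg fun k => sq_nonneg _
  have hM : ∀ k, u k ≤ M := by
    intro k
    have := hs.le_tsum k (fun j _ => sq_nonneg (u j))
    nlinarith [sq_nonneg (u k - 1)]
  have hs3 : Summable fun k => u k ^ 3 := by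
    refine Summable.of_nonneg_of_le (fun k => pow_nonneg (hupos k).le 3) (fun k => ?_)
      (hs.mul_left M)
    nlinarith [hM k, sq_nonneg (u k)]
  have hs4 : Summable fun k => u k ^ 4 := by
    refine Summable.of_nonneg_of_le (fun k => pow_nonneg (hupos k).le 4) (fun k => ?_)
      (hs3.mul_left M)
    have := pow_nonneg (hupos k).le 3
    nlinarith [hM k]
  set p2 := ∑' k, u k ^ 2 with hp2
  set p3 := ∑' k, u k ^ 3 with hp3
  obtain ⟨l, hl1, hl2⟩ := lp_prod_expand hs hs3 hs4
    ⟨M, fun k => by rw [abs_of_pos (hupos k)]; exact hM k⟩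
  have hE := lp_exp_expand (L := fun t => -α * t ^ 2 + β * t + l t) (β := β)
    (A := -α - p2 / 2) (B := -p3 / 3) (hl2.congr_left fun t => by ring)
  have hser := lp_series_expand hpos ha ha0 ha1
  have hdiff := hser.sub hE
  obtain ⟨e1, e2, e3⟩ := lp_coeff_zero (c1 := β + 1) (c2 := -α - p2 / 2 + β ^ 2 / 2 - a 2)
    (c3 := -p3 / 3 + β * (-α - p2 / 2) + β ^ 3 / 6 + a 3) (by
      refine hdiff.congr' ?_ (by rfl)
      filter_upwards [hl1] with t ht
      rw [hf' t, ht, ← Real.exp_add]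
      ring)
  have hβ : β = -1 := by linarith
  subst hβ
  have hprod : ∀ s : ℝ, 0 < s → ∀ F : Finset I, 1 ≤ Real.exp (-α * s ^ 2 + s) *
      ∏ k ∈ F, ((1 + s * u k) * Real.exp (-(s * u k))) := by
    intro s hs0 F
    have h1 := hneg s hs0.le
    rw [hf'] at h1
    have hm := lp_multipliable hs (-s)
    have e : ∀ k, (1 - -s * u k) * Real.exp (-s * u k)
        = (1 + s * u k) * Real.exp (-(s * u k)) := by
      intro k; rw [neg_mul, sub_neg_eq_add]
    simp only [e] at h1 hm
    have h2 := lp_tprod_le hm (fun k => by have := hupos k; positivity) (fun k => by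
      have := Real.add_one_le_exp (s * u k)
      rw [Real.exp_neg, ← div_eq_mul_inv, div_le_one (Real.exp_pos _)]
      linarith) F
    refine h1.trans ?_
    have e' : -α * (-s) ^ 2 + -1 * -s = -α * s ^ 2 + s := by ring
    rw [e']
    gcongr
  have hα0 : α = 0 := by
    by_contra hne
    have hαp : 0 < α := lt_of_le_of_ne hα (Ne.symm hne)
    have h1 := hprod (2 / α) (by positivity) ∅
    rw [Finset.prod_empty, mul_one, Real.one_le_exp_iff] at h1
    have e : -α * (2 / α) ^ 2 + 2 / α = -(2 / α) := by field_simp; norm_num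
    rw [e] at h1
    have : 0 < 2 / α := by positivity
    linarith
  subst hα0
  have hF : ∀ F : Finset I, ∑ k ∈ F, u k ≤ 1 := fun F =>
    lp_sum_le_one hupos F fun s hs0 => by simpa using hprod s hs0 F
  have hs1 : Summable u := summable_of_sum_le (fun k => (hupos k).le) hF
  have hp1 : ∑' k, u k ≤ 1 := hs1.tsum_le_of_sum_le hF
  have hCS : 0 ≤ p3 - 2 * p2 * p2 + p2 ^ 2 * ∑' k, u k := by
    have h1 : 0 ≤ ∑' k, u k * (u k - p2) ^ 2 :=
      tsum_nonneg fun k => mul_nonneg (hupos k).le (sq_nonneg _)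
    have e : ∑' k, u k * (u k - p2) ^ 2 = p3 - 2 * p2 * p2 + p2 ^ 2 * ∑' k, u k := by
      have := ((hs3.hasSum.sub (hs.hasSum.mul_left (2 * p2))).add
        (hs1.hasSum.mul_left (p2 ^ 2))).tsum_eq
      rw [← hp2, ← hp3] at this
      rw [← this]
      exact tsum_congr fun k => by ring
    rwa [e] at h1
  have hq : p2 ^ 2 ≤ p3 := by nlinarith [sq_nonneg p2]
  have A0 := hpos 2
  have B0 := hpos 3
  have hm := hmono 2 le_rfl
  simp only [show 2 - 1 = 1 by norm_num, show 2 - 2 = 0 by norm_num,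
    show 2 + 1 = 3 by norm_num, ha0, ha1] at hm
  rw [div_le_div_iff₀ (by positivity) (by positivity)] at hm
  rw [ha0, ha1, le_div_iff₀ (by positivity)]
  have P2 : p2 = 1 - 2 * a 2 := by linarith
  have P3 : p3 = 1 - 3 * a 2 + 3 * a 3 := by linarith
  rw [P2, P3] at hq
  have hA : a 2 ≤ 1 / 2 := by linarith
  have hm' : a 3 ≤ a 2 ^ 3 := by nlinarith
  have h9 : 0 ≤ a 2 * ((1 - 3 * a 2) * (1 - a 2)) := by nlinarith
  have h10 := nonneg_of_mul_nonneg_right h9 A0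
  have h11 := nonneg_of_mul_nonneg_left h10 (by linarith : 0 < 1 - a 2)
  linarith
end

section
/- Let φ(z) = Σ_{k=0}^∞ (-1)^k a_k z^k be an entire function with a_k > 0 for all k that belongs to the Laguerre–Pólya class (so all its zeros are real and positive). Then a_1² a_2 / a_0³ + 3 a_1 a_3 / a_0² - 4 a_2² / a_0² ≥ 0. Equivalently, writing q_2 = a_1²/(a_0 a_2) and q_3 = a_2²/(a_1 a_3), one has q_3 (q_2 - 4) + 3 ≥ 0. -/
open Filter Finset

lemma lp_le_zero (d K : ℝ) (h : ∀ s : ℝ, 0 < s → d * s ≤ K) : d ≤ 0 := by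
  by_contra hd
  push Not at hd
  have h1 := h ((|K| + 1) / d) (by positivity)
  rw [mul_div_cancel₀ _ hd.ne'] at h1
  linarith [le_abs_self K]

lemma lp_eq_zero (d C : ℝ) (h : ∀ t : ℝ, 0 < t → t ≤ 1 → |d| ≤ C * t) : d = 0 := by
  have hC : 0 ≤ C := by
    have := h 1 one_pos le_rfl
    linarith [abs_nonneg d]
  by_contra hd
  have hd' : 0 < |d| := abs_pos.mpr hd
  have hpos : 0 < |d| + C + C + 1 := by positivity
  have h1 := h (|d| / (|d| + C + C + 1)) (by positivity) (by
    rw [div_le_one hpos]; linarith)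
  have h2 : C * (|d| / (|d| + C + C + 1)) = (C * |d|) / (|d| + C + C + 1) := by ring
  rw [h2, le_div_iff₀ hpos] at h1
  nlinarith

lemma lp_coeff (d1 d2 d3 C : ℝ)
    (h : ∀ t : ℝ, 0 < t → t ≤ 1 → |d1 * t + d2 * t ^ 2 + d3 * t ^ 3| ≤ C * t ^ 4) :
    d1 = 0 ∧ d2 = 0 ∧ d3 = 0 := by
  have hC : 0 ≤ C := by
    have := h 1 one_pos le_rfl
    have h2 := abs_nonneg (d1 * 1 + d2 * 1 ^ 2 + d3 * 1 ^ 3)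
    linarith
  have e1 : d1 = 0 := by
    apply lp_eq_zero d1 (C + |d2| + |d3|)
    intro t ht ht1
    have h1 := h t ht ht1
    have h2 : |d1 * t + d2 * t ^ 2 + d3 * t ^ 3| = t * |d1 + d2 * t + d3 * t ^ 2| := by
      rw [show d1 * t + d2 * t ^ 2 + d3 * t ^ 3 = t * (d1 + d2 * t + d3 * t ^ 2) by ring, abs_mul,
        abs_of_pos ht]
    rw [h2, show C * t ^ 4 = t * (C * t ^ 3) by ring] at h1
    have h3 := le_of_mul_le_mul_left h1 ht
    have h4 : |d1| ≤ |d1 + d2 * t + d3 * t ^ 2| + |d2 * t + d3 * t ^ 2| := by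
      have := abs_sub (d1 + d2 * t + d3 * t ^ 2) (d2 * t + d3 * t ^ 2)
      rwa [show d1 + d2 * t + d3 * t ^ 2 - (d2 * t + d3 * t ^ 2) = d1 by ring] at this
    have h5 : |d2 * t + d3 * t ^ 2| ≤ |d2| * t + |d3| * t ^ 2 := by
      refine (abs_add_le _ _).trans ?_
      rw [abs_mul, abs_mul, abs_of_pos ht, abs_of_pos (pow_pos ht 2)]
    have h6 : t ^ 2 ≤ t := by nlinarith
    have h7 : t ^ 3 ≤ t := by nlinarith
    have := mul_le_mul_of_nonneg_left h6 (abs_nonneg d3)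
    have := mul_le_mul_of_nonneg_left h7 hC
    nlinarith
  subst e1
  have e2 : d2 = 0 := by
    apply lp_eq_zero d2 (C + |d3|)
    intro t ht ht1
    have h1 := h t ht ht1
    have h2 : |0 * t + d2 * t ^ 2 + d3 * t ^ 3| = t ^ 2 * |d2 + d3 * t| := by
      rw [show 0 * t + d2 * t ^ 2 + d3 * t ^ 3 = t ^ 2 * (d2 + d3 * t) by ring, abs_mul,
        abs_of_pos (pow_pos ht 2)]
    rw [h2, show C * t ^ 4 = t ^ 2 * (C * t ^ 2) by ring] at h1
    have h3 := le_of_mul_le_mul_left h1 (pow_pos ht 2)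
    have h4 : |d2| ≤ |d2 + d3 * t| + |d3 * t| := by
      have := abs_sub (d2 + d3 * t) (d3 * t)
      rwa [show d2 + d3 * t - d3 * t = d2 by ring] at this
    rw [abs_mul d3, abs_of_pos ht] at h4
    have h6 : t ^ 2 ≤ t := by nlinarith
    have := mul_le_mul_of_nonneg_left h6 hC
    nlinarith
  subst e2
  refine ⟨rfl, rfl, ?_⟩
  apply lp_eq_zero d3 C
  intro t ht ht1
  have h1 := h t ht ht1
  rw [show 0 * t + 0 * t ^ 2 + d3 * t ^ 3 = t ^ 3 * d3 by ring, abs_mul,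
        abs_of_pos (pow_pos ht 3), show C * t ^ 4 = t ^ 3 * (C * t) by ring] at h1
  exact le_of_mul_le_mul_left h1 (pow_pos ht 3)

lemma lp_log_upper (x : ℝ) (hx : 0 ≤ x) :
    Real.log (1 + x) ≤ x - x ^ 2 / 2 + x ^ 3 / 3 := by
  have hm : MonotoneOn (fun x : ℝ => x - x ^ 2 / 2 + x ^ 3 / 3 - Real.log (1 + x)) (Set.Ici 0) := by
    apply monotoneOn_of_hasDerivWithinAt_nonneg (convex_Ici 0)
      (f' := fun x => 1 - x + x ^ 2 - 1 / (1 + x))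
    · apply ContinuousOn.sub (by fun_prop)
      apply ContinuousOn.log (by fun_prop)
      intro y hy
      have : (0:ℝ) ≤ y := hy
      positivity
    · intro y hy
      rw [interior_Ici] at hy
      have hy' : (0:ℝ) < y := hy
      apply HasDerivAt.hasDerivWithinAt
      have h1 := ((hasDerivAt_id y).const_add 1).log (by simp; positivity)
      have h2 := (((hasDerivAt_id y).sub ((hasDerivAt_pow 2 y).div_const 2)).add
        ((hasDerivAt_pow 3 y).div_const 3)).sub h1
      refine HasDerivAt.congr_deriv h2 ?_
      simp only [id]
      norm_num
      try ring
    · intro y hy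
      rw [interior_Ici] at hy
      have hy' : (0:ℝ) < y := hy
      have : 1 - y + y ^ 2 - 1 / (1 + y) = y ^ 3 / (1 + y) := by field_simp; ring
      rw [this]; positivity
  have := hm (Set.mem_Ici.mpr le_rfl) (Set.mem_Ici.mpr hx) hx
  simp at this
  linarith

lemma lp_log_lower (x : ℝ) (hx : 0 ≤ x) :
    x - x ^ 2 / 2 + x ^ 3 / 3 - x ^ 4 / 4 ≤ Real.log (1 + x) := by
  have hm : MonotoneOn (fun x : ℝ => Real.log (1 + x) -
      (x - x ^ 2 / 2 + x ^ 3 / 3 - x ^ 4 / 4)) (Set.Ici 0) := by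
    apply monotoneOn_of_hasDerivWithinAt_nonneg (convex_Ici 0)
      (f' := fun x => 1 / (1 + x) - (1 - x + x ^ 2 - x ^ 3))
    · apply ContinuousOn.sub _ (by fun_prop)
      apply ContinuousOn.log (by fun_prop)
      intro y hy
      have : (0:ℝ) ≤ y := hy
      positivity
    · intro y hy
      rw [interior_Ici] at hy
      have hy' : (0:ℝ) < y := hy
      apply HasDerivAt.hasDerivWithinAt
      have h1 := ((hasDerivAt_id y).const_add 1).log (by simp; positivity)
      have h2 := h1.sub ((((hasDerivAt_id y).sub ((hasDerivAt_pow 2 y).div_const 2)).add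
        ((hasDerivAt_pow 3 y).div_const 3)).sub ((hasDerivAt_pow 4 y).div_const 4))
      refine HasDerivAt.congr_deriv h2 ?_
      simp only [id]
      norm_num
      try ring
    · intro y hy
      rw [interior_Ici] at hy
      have hy' : (0:ℝ) < y := hy
      have : 1 / (1 + y) - (1 - y + y ^ 2 - y ^ 3) = y ^ 4 / (1 + y) := by field_simp; ring
      rw [this]; positivity
  have := hm (Set.mem_Ici.mpr le_rfl) (Set.mem_Ici.mpr hx) hx
  simp at this
  linarith

lemma lp_log_lower2 (x : ℝ) (hx : 0 ≤ x) : x - x ^ 2 / 2 ≤ Real.log (1 + x) := by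
  have h := Real.le_log_one_add_of_nonneg hx
  refine le_trans ?_ h
  rw [le_div_iff₀ (by linarith)]
  nlinarith [pow_nonneg hx 3]

/-- expansion of the log of the power series -/
lemma lp_series (b : ℕ → ℝ) (hb : ∀ k, 0 < b k) (hb0 : b 0 = 1)
    (hs : ∀ t : ℝ, Summable fun k => b k * t ^ k) :
    ∃ C : ℝ, ∀ t : ℝ, 0 < t → t ≤ 1 →
      |Real.log (∑' k, b k * t ^ k) - (b 1 * t - (b 1 ^ 2 - 2 * b 2) / 2 * t ^ 2
        + (b 1 ^ 3 - 3 * b 1 * b 2 + 3 * b 3) / 3 * t ^ 3)| ≤ C * t ^ 4 := by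
  have hs4 : ∀ t : ℝ, Summable fun k => b (k + 4) * t ^ k := by
    intro t
    by_cases ht : t = 0
    · subst ht
      apply summable_of_ne_finset_zero (s := {0})
      intro k hk
      simp at hk
      simp [hk]
    · have h1 := (summable_nat_add_iff 4).mpr (hs t)
      have h2 := h1.mul_right ((t ^ 4)⁻¹)
      refine h2.congr fun k => ?_
      rw [pow_add]
      field_simp
  set B : ℝ := ∑' k, b (k + 4) * 1 ^ k with hB
  set Q : ℝ × ℝ → ℝ := fun p => p.2 - (b 2 ^ 2 + 2 * b 1 * (b 3 + p.2 * p.1)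
      + 2 * b 2 * (b 3 + p.2 * p.1) * p.1 + (b 3 + p.2 * p.1) ^ 2 * p.1 ^ 2) / 2
      + (3 * b 1 ^ 2 * (b 2 + p.1 * (b 3 + p.2 * p.1))
        + 3 * b 1 * (b 2 + p.1 * (b 3 + p.2 * p.1)) ^ 2 * p.1
        + (b 2 + p.1 * (b 3 + p.2 * p.1)) ^ 3 * p.1 ^ 2) / 3 with hQ
  set V : ℝ × ℝ → ℝ := fun p => b 1 + b 2 * p.1 + b 3 * p.1 ^ 2 + p.2 * p.1 ^ 3 with hV
  have hK : IsCompact (Set.Icc (0:ℝ) 1 ×ˢ Set.Icc (0:ℝ) B) := isCompact_Icc.prod isCompact_Icc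
  obtain ⟨C1, hC1⟩ := hK.exists_bound_of_continuousOn (f := Q) (by fun_prop)
  obtain ⟨C2, hC2⟩ := hK.exists_bound_of_continuousOn (f := fun p => V p ^ 4) (by fun_prop)
  refine ⟨C1 + C2, fun t ht ht1 => ?_⟩
  set r : ℝ := ∑' k, b (k + 4) * t ^ k with hr
  have hr0 : 0 ≤ r := tsum_nonneg fun k => by have := hb (k + 4); positivity
  have hrB : r ≤ B := (hs4 t).tsum_le_tsum (fun k => by
    have := hb (k + 4)
    have h2 : t ^ k ≤ 1 ^ k := by gcongr
    gcongr) (hs4 1)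
  have hsum : ∑' k, b k * t ^ k = 1 + t * V (t, r) := by
    rw [← (hs t).sum_add_tsum_nat_add 4]
    have : ∑' k, b (k + 4) * t ^ (k + 4) = r * t ^ 4 := by
      rw [hr, ← tsum_mul_right]
      congr 1; ext k; ring
    rw [this]
    simp [Finset.sum_range_succ, hb0, hV]
    ring
  have hmem : (t, r) ∈ Set.Icc (0:ℝ) 1 ×ˢ Set.Icc (0:ℝ) B := ⟨⟨ht.le, ht1⟩, ⟨hr0, hrB⟩⟩
  have q1 := hC1 _ hmem
  have q2 := hC2 _ hmem
  rw [Real.norm_eq_abs] at q1 q2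
  have hV0 : 0 ≤ V (t, r) := by
    have := hb 1; have := hb 2; have := hb 3
    simp only [hV]; positivity
  have hw : 0 ≤ t * V (t, r) := by positivity
  have u1 := lp_log_upper _ hw
  have u2 := lp_log_lower _ hw
  have key : t * V (t, r) - (t * V (t, r)) ^ 2 / 2 + (t * V (t, r)) ^ 3 / 3 =
      (b 1 * t - (b 1 ^ 2 - 2 * b 2) / 2 * t ^ 2
        + (b 1 ^ 3 - 3 * b 1 * b 2 + 3 * b 3) / 3 * t ^ 3) + t ^ 4 * Q (t, r) := by
    simp only [hV, hQ]; ring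
  rw [hsum]
  clear_value Q V r B
  generalize V (t, r) = v at *
  generalize Q (t, r) = q at *
  have ht4 : 0 < t ^ 4 := by positivity
  have v1 := mul_le_mul_of_nonneg_left (abs_le.mp q1).1 ht4.le
  have v2 := mul_le_mul_of_nonneg_left (abs_le.mp q1).2 ht4.le
  have v3 := mul_le_mul_of_nonneg_left (abs_le.mp q2).2 ht4.le
  have v4 : 0 ≤ t ^ 4 * v ^ 4 := by positivity
  have v5 : (t * v) ^ 4 = t ^ 4 * v ^ 4 := by ring
  rw [v5] at u2
  rw [abs_le]
  constructor
  · linarith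
  · linarith

lemma lp_summable_g {ι : Type*} (u : ι → ℝ) (hu : ∀ k, 0 ≤ u k) (hs : Summable fun k => u k ^ 2)
    (t : ℝ) (ht : 0 ≤ t) : Summable fun k => Real.log (1 + t * u k) - t * u k := by
  apply Summable.of_norm_bounded (g := fun k => t ^ 2 / 2 * u k ^ 2) (hs.mul_left _)
  intro k
  have h0 : 0 ≤ t * u k := mul_nonneg ht (hu k)
  have h1 := lp_log_lower2 _ h0
  have h2 := Real.log_le_sub_one_of_pos (show 0 < 1 + t * u k by linarith)
  rw [Real.norm_eq_abs, abs_le]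
  constructor <;> nlinarith [sq_nonneg (t * u k)]

lemma lp_summable_pow {ι : Type*} (u : ι → ℝ) (hu : ∀ k, 0 ≤ u k)
    (hs : Summable fun k => u k ^ 2) :
    (Summable fun k => u k ^ 3) ∧ (Summable fun k => u k ^ 4) := by
  have hbd : ∀ k, u k ^ 2 ≤ ∑' j, u j ^ 2 := fun k =>
    hs.le_tsum k (fun j _ => sq_nonneg _)
  set S := ∑' j, u j ^ 2 with hS
  constructor
  · apply Summable.of_nonneg_of_le (fun k => pow_nonneg (hu k) 3) _ (hs.mul_left (S + 1))
    intro k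
    have h1 := hbd k
    have h2 : u k ≤ S + 1 := by nlinarith [sq_nonneg (u k - 1)]
    calc u k ^ 3 = u k * u k ^ 2 := by ring
      _ ≤ _ := by gcongr
  · apply Summable.of_nonneg_of_le (fun k => pow_nonneg (hu k) 4) _ (hs.mul_left S)
    intro k
    have h1 := hbd k
    calc u k ^ 4 = u k ^ 2 * u k ^ 2 := by ring
      _ ≤ _ := by gcongr

lemma lp_g_expand {ι : Type*} (u : ι → ℝ) (hu : ∀ k, 0 ≤ u k)
    (hs : Summable fun k => u k ^ 2) (t : ℝ) (ht : 0 ≤ t) :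
    |∑' k, (Real.log (1 + t * u k) - t * u k) - (-(∑' k, u k ^ 2) / 2 * t ^ 2
      + (∑' k, u k ^ 3) / 3 * t ^ 3)| ≤ (∑' k, u k ^ 4) / 4 * t ^ 4 := by
  obtain ⟨h3, h4⟩ := lp_summable_pow u hu hs
  have hg := lp_summable_g u hu hs t ht
  have H : HasSum (fun k => u k ^ 2 * (-t ^ 2 / 2) + u k ^ 3 * (t ^ 3 / 3))
      ((∑' k, u k ^ 2) * (-t ^ 2 / 2) + (∑' k, u k ^ 3) * (t ^ 3 / 3)) :=
    (hs.hasSum.mul_right _).add (h3.hasSum.mul_right _)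
  have H4 := h4.hasSum.mul_right (t ^ 4 / 4)
  have A : ∑' k, (Real.log (1 + t * u k) - t * u k) ≤
      (∑' k, u k ^ 2) * (-t ^ 2 / 2) + (∑' k, u k ^ 3) * (t ^ 3 / 3) := by
    refine hasSum_le ?_ hg.hasSum H
    intro k
    have := lp_log_upper _ (mul_nonneg ht (hu k))
    nlinarith
  have B : ((∑' k, u k ^ 2) * (-t ^ 2 / 2) + (∑' k, u k ^ 3) * (t ^ 3 / 3))
      - (∑' k, u k ^ 4) * (t ^ 4 / 4) ≤ ∑' k, (Real.log (1 + t * u k) - t * u k) := by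
    refine hasSum_le ?_ (H.sub H4) hg.hasSum
    intro k
    have := lp_log_lower _ (mul_nonneg ht (hu k))
    nlinarith
  have p4 : 0 ≤ ∑' k, u k ^ 4 := tsum_nonneg fun k => pow_nonneg (hu k) 4
  have : 0 ≤ (∑' k, u k ^ 4) * (t ^ 4 / 4) := by positivity
  rw [abs_le]
  constructor <;> nlinarith

/-- The core inequality from the log representation on the positive axis. -/
lemma lp_core {ι : Type*} (b : ℕ → ℝ) (hb : ∀ k, 0 < b k) (hb0 : b 0 = 1)
    (hsb : ∀ t : ℝ, Summable fun k => b k * t ^ k)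
    (u : ι → ℝ) (hu : ∀ k, 0 ≤ u k) (hs : Summable fun k => u k ^ 2) (α β : ℝ) (hα : 0 ≤ α)
    (hrep : ∀ t : ℝ, 0 < t → Real.log (∑' k, b k * t ^ k) =
      -α * t ^ 2 - β * t + ∑' k, (Real.log (1 + t * u k) - t * u k)) :
    (b 1 ^ 2 - 2 * b 2) ^ 2 ≤ b 1 * (b 1 ^ 3 - 3 * b 1 * b 2 + 3 * b 3) := by
  have hfin : ∀ (F : Finset ι) (t : ℝ), 0 < t →
      0 ≤ -α * t ^ 2 - β * t + ∑ k ∈ F, (Real.log (1 + t * u k) - t * u k) := by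
    intro F t ht
    have h1 : 1 ≤ ∑' k, b k * t ^ k := by
      have := (hsb t).le_tsum 0 (fun j _ => by have := hb j; positivity)
      simpa [hb0] using this
    have h2 := Real.log_nonneg h1
    rw [hrep t ht] at h2
    have h3 := (lp_summable_g u hu hs t ht.le).neg.sum_le_tsum F (fun k _ => by
      have h0 : 0 ≤ t * u k := mul_nonneg ht.le (hu k)
      have := Real.log_le_sub_one_of_pos (show 0 < 1 + t * u k by linarith)
      linarith)
    rw [tsum_neg, Finset.sum_neg_distrib] at h3
    linarith
  have hα0 : α = 0 := by
    refine le_antisymm (lp_le_zero α (-β) fun s hs0 => ?_) hα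
    have h := hfin ∅ s hs0
    simp only [Finset.sum_empty] at h
    have : s * (α * s) ≤ s * (-β) := by nlinarith
    exact le_of_mul_le_mul_left this hs0
  subst hα0
  have hS1 : ∀ F : Finset ι, ∑ k ∈ F, u k ≤ -β := by
    intro F
    suffices ∑ k ∈ F, u k + β ≤ 0 by linarith
    apply lp_le_zero _ (2 * ∑ k ∈ F, Real.sqrt (u k))
    intro s hs0
    have h := hfin F (s ^ 2) (by positivity)
    have h2 : ∑ k ∈ F, (Real.log (1 + s ^ 2 * u k) - s ^ 2 * u k) ≤
        ∑ k ∈ F, (2 * s * Real.sqrt (u k) - s ^ 2 * u k) := by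
      apply Finset.sum_le_sum
      intro k _
      have hq := Real.sqrt_nonneg (u k)
      have hqq := Real.sq_sqrt (hu k)
      have hsq : 0 ≤ s * Real.sqrt (u k) := by positivity
      have l1 : Real.log (1 + s ^ 2 * u k) ≤ Real.log ((1 + s * Real.sqrt (u k)) ^ 2) := by
        apply Real.log_le_log
        · have := hu k; positivity
        · rw [← hqq]; simp only [Real.sqrt_sq hq]; nlinarith
      rw [Real.log_pow] at l1
      have l2 := Real.log_le_sub_one_of_pos (show 0 < 1 + s * Real.sqrt (u k) by linarith)
      push_cast at l1
      linarith
    have h5 : ∑ k ∈ F, (2 * s * Real.sqrt (u k) - s ^ 2 * u k) =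
        2 * s * ∑ k ∈ F, Real.sqrt (u k) - s ^ 2 * ∑ k ∈ F, u k := by
      rw [Finset.sum_sub_distrib, ← Finset.mul_sum, ← Finset.mul_sum]
    rw [h5] at h2
    have : s * ((∑ k ∈ F, u k + β) * s) ≤ s * (2 * ∑ k ∈ F, Real.sqrt (u k)) := by nlinarith
    exact le_of_mul_le_mul_left this hs0
  obtain ⟨C, hC⟩ := lp_series b hb hb0 hsb
  obtain ⟨h3, h4⟩ := lp_summable_pow u hu hs
  set S2 := ∑' k, u k ^ 2 with hS2
  set S3 := ∑' k, u k ^ 3 with hS3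
  obtain ⟨e1, e2, e3⟩ := lp_coeff (b 1 + β) (-(b 1 ^ 2 - 2 * b 2) / 2 + S2 / 2)
    ((b 1 ^ 3 - 3 * b 1 * b 2 + 3 * b 3) / 3 - S3 / 3) (C + (∑' k, u k ^ 4) / 4) (by
      intro t ht ht1
      have k1 := abs_le.mp (hC t ht ht1)
      have k2 := abs_le.mp (lp_g_expand u hu hs t ht.le)
      rw [hrep t ht] at k1
      obtain ⟨k11, k12⟩ := k1
      obtain ⟨k21, k22⟩ := k2
      rw [abs_le]
      constructor <;> nlinarith)
  have hb1 : -β = b 1 := by linarith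
  have hp2 : b 1 ^ 2 - 2 * b 2 = S2 := by linarith
  have hp3 : b 1 ^ 3 - 3 * b 1 * b 2 + 3 * b 3 = S3 := by linarith
  rw [hp2, hp3]
  have hS20 : 0 ≤ S2 := tsum_nonneg fun k => sq_nonneg _
  have hS30 : 0 ≤ S3 := tsum_nonneg fun k => pow_nonneg (hu k) 3
  have hle : S2 ≤ Real.sqrt (b 1 * S3) := by
    apply hs.tsum_le_of_sum_le
    intro F
    apply Real.le_sqrt_of_sq_le
    calc (∑ k ∈ F, u k ^ 2) ^ 2 ≤ (∑ k ∈ F, u k) * ∑ k ∈ F, u k ^ 3 :=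
          Finset.sum_sq_le_sum_mul_sum_of_sq_le_mul F (fun k _ => hu k)
            (fun k _ => pow_nonneg (hu k) 3) (fun k _ => le_of_eq (by ring))
      _ ≤ b 1 * S3 := by
          have := hS1 F
          rw [hb1] at this
          have := h3.sum_le_tsum F (fun k _ => pow_nonneg (hu k) 3)
          have := hb 1
          have : 0 ≤ ∑ k ∈ F, u k ^ 3 := Finset.sum_nonneg fun k _ => pow_nonneg (hu k) 3
          gcongr
  have := Real.sq_sqrt (show 0 ≤ b 1 * S3 by have := hb 1; positivity)
  nlinarith

/-- if `φ(z) = ∑ (-1)ᵏ aₖ zᵏ` is entire with `aₖ > 0` and belongs to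
the Laguerre–Pólya class, then `a₁²a₂/a₀³ + 3a₁a₃/a₀² - 4a₂²/a₀² ≥ 0`;
equivalently `q₃(q₂ - 4) + 3 ≥ 0`. -/
theorem statement3 (a : ℕ → ℝ) (hpos : ∀ k, 0 < a k)
    (hent : ∀ z : ℂ, Summable fun k : ℕ => (-1 : ℂ) ^ k * (a k : ℂ) * z ^ k)
    (hLP : LaguerrePolya (fun x : ℝ => ∑' k : ℕ, (-1 : ℝ) ^ k * a k * x ^ k)) :
    0 ≤ a 1 ^ 2 * a 2 / a 0 ^ 3 + 3 * (a 1 * a 3) / a 0 ^ 2 - 4 * a 2 ^ 2 / a 0 ^ 2 ∧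
    0 ≤ (a 2 ^ 2 / (a 1 * a 3)) * (a 1 ^ 2 / (a 0 * a 2) - 4) + 3 := by
  have hsr : ∀ t : ℝ, Summable fun k => a k * t ^ k := by
    intro t
    have h := hent (-(t : ℂ))
    rw [← Complex.summable_ofReal]
    convert h using 2 with k
    push_cast
    rw [neg_pow (t : ℂ) k]
    have : ((-1 : ℂ) ^ k) * (-1) ^ k = 1 := by rw [← mul_pow]; simp
    linear_combination (-(a k : ℂ) * t ^ k) * this
  obtain ⟨c, α, β, n, I, x, hα, hx0, hsx, hrep⟩ := hLP
  have hneg : ∀ t : ℝ, ∑' k : ℕ, (-1 : ℝ) ^ k * a k * (-t) ^ k = ∑' k, a k * t ^ k := by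
    intro t
    congr 1; ext k
    rw [neg_pow t k]
    have : ((-1 : ℝ) ^ k) * (-1) ^ k = 1 := by rw [← mul_pow]; simp
    linear_combination (a k * t ^ k) * this
  have hF : ∀ t : ℝ, 0 ≤ t → a 0 ≤ ∑' k, a k * t ^ k := by
    intro t ht
    have := (hsr t).le_tsum 0 (fun j _ => by have := hpos j; positivity)
    simpa using this
  have ha0 := hpos 0
  have hn : n = 0 := by
    by_contra hn
    have h := hrep (-0)
    simp only [hneg] at h
    rw [neg_zero, zero_pow hn] at h
    have := hF 0 le_rfl
    rw [h] at this
    simp at this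
    linarith
  subst hn
  have hc : c = a 0 := by
    have h := hrep 0
    simp only [zero_div, sub_zero, Real.exp_zero, mul_one, tprod_one, pow_zero] at h
    rw [tsum_eq_single 0 (by intro k hk; simp [hk])] at h
    simp at h
    exact h.symm
  subst hc
  have hxpos : ∀ k : I, 0 < x k := by
    intro k
    have hne := hx0 k k.2
    by_contra hlt
    have hlt' : x k < 0 := lt_of_le_of_ne (not_lt.mp hlt) hne
    have h := hrep (-(-(x k)))
    simp only [hneg] at h
    rw [tprod_of_exists_eq_zero ⟨k, by simp [hne]⟩, mul_zero] at h
    have := hF (-(x k)) (by linarith)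
    linarith
  have hcore := lp_core (fun k => a k / a 0) (fun k => div_pos (hpos k) ha0) (div_self ha0.ne')
    (fun t => by
      have := (hsr t).div_const (a 0)
      refine this.congr fun k => ?_
      ring)
    (fun k : I => (x k)⁻¹) (fun k => (inv_pos.mpr (hxpos k)).le) hsx α β hα (by
      intro t ht
      have hfp : ∀ k : I, 0 < (1 - (-t) / x k) * Real.exp ((-t) / x k) := by
        intro k
        have := hxpos k
        have : 0 < 1 - (-t) / x k := by
          rw [neg_div, sub_neg_eq_add]; positivity
        positivity
      have hlog : ∀ k : I, Real.log ((1 - (-t) / x k) * Real.exp ((-t) / x k)) =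
          Real.log (1 + t * (x k)⁻¹) - t * (x k)⁻¹ := by
        intro k
        have := hxpos k
        have h1 : 1 - (-t) / x k = 1 + t * (x k)⁻¹ := by ring
        rw [h1, Real.log_mul (by positivity) (Real.exp_ne_zero _), Real.log_exp]
        ring
      have hsg := lp_summable_g (fun k : I => (x k)⁻¹)
        (fun k => (inv_pos.mpr (hxpos k)).le) hsx t ht.le
      have hE := Real.rexp_tsum_eq_tprod hfp (by simpa only [hlog] using hsg)
      simp only [hlog] at hE
      have h := hrep (-t)
      simp only [hneg] at h
      rw [← hE] at h
      have h2 : ∑' k, a k / a 0 * t ^ k = (∑' k, a k * t ^ k) / a 0 := by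
        rw [← tsum_div_const]
        congr 1; ext k; ring
      rw [h2, h, pow_zero, mul_one, mul_assoc, ← Real.exp_add, mul_div_cancel_left₀ _ ha0.ne',
        Real.log_exp]
      ring)
  have ha1 := hpos 1
  have ha2 := hpos 2
  have ha3 := hpos 3
  have hfirst : 0 ≤ a 1 ^ 2 * a 2 / a 0 ^ 3 + 3 * (a 1 * a 3) / a 0 ^ 2
      - 4 * a 2 ^ 2 / a 0 ^ 2 := by
    have : a 1 ^ 2 * a 2 / a 0 ^ 3 + 3 * (a 1 * a 3) / a 0 ^ 2 - 4 * a 2 ^ 2 / a 0 ^ 2 =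
        a 1 / a 0 * ((a 1 / a 0) ^ 3 - 3 * (a 1 / a 0) * (a 2 / a 0) + 3 * (a 3 / a 0)) -
          ((a 1 / a 0) ^ 2 - 2 * (a 2 / a 0)) ^ 2 := by
      field_simp; ring
    rw [this]
    exact sub_nonneg.mpr hcore
  refine ⟨hfirst, ?_⟩
  have : (a 2 ^ 2 / (a 1 * a 3)) * (a 1 ^ 2 / (a 0 * a 2) - 4) + 3 =
      (a 0 ^ 2 / (a 1 * a 3)) * (a 1 ^ 2 * a 2 / a 0 ^ 3 + 3 * (a 1 * a 3) / a 0 ^ 2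
      - 4 * a 2 ^ 2 / a 0 ^ 2) := by
    field_simp
    ring
  rw [this]
  positivity
end
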